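/- arXiv:2312.12238 — 6 statements merged into one kernel-verified Lean document; each statement's English description precedes it below -/
import Mathlib

section
/- Under the Setup, a right S-module m has finite projective dimension over S if and only if G(m) has finite projective dimension over R. -/
/-!
Statement 2: Under the Setup (R, S Gorenstein rings, adjoint triple L ⊣ G ⊣ R′ of additive
functors between the categories of right modules, with G fully faithful and L exact), a right
S-module m has finite projective dimension over S iff G(m) has finite projective dimension
over R.  Right A-modules are formalized as objects of `ModuleCat Aᵐᵒᵖ`.
-/

open CategoryTheory CategoryTheory.Abelian CategoryTheory.Limits

universe u

noncomputable instance moduleCatHasExt (A : Type u) [Ring A] :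
    HasExt.{u + 1} (ModuleCat.{u} A) := by
  letI := HasDerivedCategory.standard (ModuleCat.{u} A)
  exact hasExt_of_hasDerivedCategory _

/-- `M` has finite projective dimension: there is `d` such that `Ext^i(M, N) = 0`
for every module `N` and every `i > d`. -/
def HasFinProjDim (A : Type u) [Ring A] (M : ModuleCat.{u} A) : Prop :=
  ∃ d : ℕ, ∀ (N : ModuleCat.{u} A) (i : ℕ), d < i → Subsingleton (Ext M N i)

/-- `M` has finite injective dimension: there is `d` such that `Ext^i(N, M) = 0`
for every module `N` and every `i > d`. -/
def HasFinInjDim (A : Type u) [Ring A] (M : ModuleCat.{u} A) : Prop :=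
  ∃ d : ℕ, ∀ (N : ModuleCat.{u} A) (i : ℕ), d < i → Subsingleton (Ext N M i)

/-- A ring is Gorenstein if it is left and right Noetherian and has finite injective
dimension as a right module and as a left module over itself. -/
def IsGorensteinRing (A : Type u) [Ring A] : Prop :=
  IsNoetherianRing A ∧ IsNoetherianRing Aᵐᵒᵖ ∧
    HasFinInjDim Aᵐᵒᵖ (ModuleCat.of Aᵐᵒᵖ A) ∧
    HasFinInjDim A (ModuleCat.of A A)

namespace CategoryTheory

variable {C : Type*} [Category C] [Abelian C] {D : Type*} [Category D] [Abelian D]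

lemma hasProjectiveDimensionLT_map_of_exact [EnoughProjectives C] (F : C ⥤ D) [F.Additive]
    [PreservesFiniteLimits F] [PreservesFiniteColimits F]
    (hF : ∀ P : C, Projective P → Projective (F.obj P)) {X : C} {n : ℕ}
    (hX : HasProjectiveDimensionLT X n) : HasProjectiveDimensionLT (F.obj X) n := by
  induction n generalizing X with
  | zero =>
    rw [hasProjectiveDimensionLT_zero_iff_isZero] at hX ⊢
    exact F.map_isZero hX
  | succ n ih =>
    rcases n with _ | n
    · exact projective_iff_hasProjectiveDimensionLT_one.mp
        (hF X (projective_iff_hasProjectiveDimensionLT_one.mpr hX))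
    · obtain ⟨p⟩ := EnoughProjectives.presentation X
      have h : (ShortComplex.mk _ _ (kernel.condition p.f)).ShortExact :=
        { exact := ShortComplex.exact_kernel p.f }
      have h₁ := (h.hasProjectiveDimensionLT_X₃_iff n p.projective).mp hX
      exact ((h.map_of_exact F).hasProjectiveDimensionLT_X₃_iff n (hF _ p.projective)).mpr (ih h₁)

lemma hasInjectiveDimensionLT_map_of_exact [EnoughInjectives C] (F : C ⥤ D) [F.Additive]
    [PreservesFiniteLimits F] [PreservesFiniteColimits F]
    (hF : ∀ I : C, Injective I → Injective (F.obj I)) {X : C} {n : ℕ}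
    (hX : HasInjectiveDimensionLT X n) : HasInjectiveDimensionLT (F.obj X) n := by
  induction n generalizing X with
  | zero =>
    rw [hasInjectiveDimensionLT_zero_iff_isZero] at hX ⊢
    exact F.map_isZero hX
  | succ n ih =>
    rcases n with _ | n
    · exact injective_iff_hasInjectiveDimensionLT_one.mp
        (hF X (injective_iff_hasInjectiveDimensionLT_one.mpr hX))
    · obtain ⟨p⟩ := EnoughInjectives.presentation X
      have h : (ShortComplex.mk _ _ (cokernel.condition p.f)).ShortExact :=
        { exact := ShortComplex.exact_cokernel p.f }
      have h₁ := (h.hasInjectiveDimensionLT_X₃_iff n p.injective).mpr hX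
      exact ((h.map_of_exact F).hasInjectiveDimensionLT_X₃_iff n (hF _ p.injective)).mp (ih h₁)

namespace ShortComplex.ShortExact

universe w
variable [HasExt.{w} C] {S : ShortComplex C}

lemma subsingleton_ext_X₁ (hS : S.ShortExact) [Projective S.X₂] {Y : C} {i : ℕ}
    (h : Subsingleton (Ext.{w} S.X₃ Y (i + 2))) : Subsingleton (Ext.{w} S.X₁ Y (i + 1)) :=
  subsingleton_of_forall_eq 0 fun x ↦ by
    obtain ⟨y, rfl⟩ := Ext.contravariant_sequence_exact₁ hS Y x (n₁ := i + 2) (by lia)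
      (Subsingleton.elim _ _)
    rw [Ext.eq_zero_of_projective y, Ext.comp_zero]

lemma subsingleton_ext_X₃ (hS : S.ShortExact) [Projective S.X₂] {Y : C} {i : ℕ}
    (h : Subsingleton (Ext.{w} S.X₁ Y (i + 1))) : Subsingleton (Ext.{w} S.X₃ Y (i + 2)) :=
  subsingleton_of_forall_eq 0 fun x ↦ by
    obtain ⟨y, rfl⟩ := Ext.contravariant_sequence_exact₃ hS Y x
      (Ext.eq_zero_of_projective _) (n₀ := i + 1) (by lia)
    rw [Subsingleton.elim y 0, Ext.comp_zero]

lemma subsingleton_ext_cosyzygy (hS : S.ShortExact) [Injective S.X₂] {X : C} {i : ℕ}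
    (h : Subsingleton (Ext.{w} X S.X₁ (i + 2))) : Subsingleton (Ext.{w} X S.X₃ (i + 1)) :=
  subsingleton_of_forall_eq 0 fun x ↦ by
    obtain ⟨y, rfl⟩ := Ext.covariant_sequence_exact₃ X hS x (n₁ := i + 2) (by lia)
      (Subsingleton.elim _ _)
    rw [Ext.eq_zero_of_injective y, Ext.zero_comp]

lemma exists_extension (hS : S.ShortExact) {Y : C} (h : Subsingleton (Ext.{w} S.X₃ Y 1))
    (f : S.X₁ ⟶ Y) : ∃ g : S.X₂ ⟶ Y, S.f ≫ g = f := by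
  obtain ⟨x, hx⟩ := Ext.contravariant_sequence_exact₁ hS Y (Ext.mk₀ f) (n₁ := 1) (by lia)
    (Subsingleton.elim _ _)
  obtain ⟨g, rfl⟩ := Ext.homEquiv₀.symm.surjective x
  exact ⟨g, Ext.homEquiv₀.symm.injective (by simpa using hx)⟩

lemma subsingleton_ext_one_of_exists_extension (hS : S.ShortExact) [Projective S.X₂] {Y : C}
    (h : ∀ f : S.X₁ ⟶ Y, ∃ g : S.X₂ ⟶ Y, S.f ≫ g = f) : Subsingleton (Ext.{w} S.X₃ Y 1) :=
  subsingleton_of_forall_eq 0 fun x ↦ by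
    obtain ⟨y, rfl⟩ := Ext.contravariant_sequence_exact₃ hS Y x
      (Ext.eq_zero_of_projective _) (n₀ := 0) (by lia)
    obtain ⟨f, rfl⟩ := Ext.homEquiv₀.symm.surjective y
    obtain ⟨g, rfl⟩ := h f
    have := hS.extClass_comp_assoc (Ext.mk₀ g) (h := rfl)
    simpa using this

lemma projective_X₃_of_subsingleton_ext (hS : S.ShortExact) [Projective S.X₂]
    (h : Subsingleton (Ext.{w} S.X₃ S.X₁ 1)) : Projective S.X₃ := by
  obtain ⟨x, hx⟩ := Ext.covariant_sequence_exact₃ S.X₃ hS (Ext.mk₀ (𝟙 S.X₃)) (n₁ := 1) rfl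
    (Subsingleton.elim _ _)
  obtain ⟨s, rfl⟩ := Ext.homEquiv₀.symm.surjective x
  have hs : s ≫ S.g = 𝟙 _ := Ext.homEquiv₀.symm.injective (by simpa using hx)
  exact Retract.projective ⟨s, S.g, hs⟩

end ShortComplex.ShortExact

end CategoryTheory

lemma hasFinProjDim_iff {A : Type u} [Ring A] {M : ModuleCat.{u} A} :
    HasFinProjDim A M ↔ ∃ d, HasProjectiveDimensionLT M d := by
  refine ⟨fun ⟨d, h⟩ ↦ ⟨d + 1, HasProjectiveDimensionLT.mk fun i hi Y e ↦
    have := h Y i hi; Subsingleton.elim _ _⟩, fun ⟨d, h⟩ ↦ ⟨d, fun N i hi ↦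
      HasProjectiveDimensionLT.subsingleton M d i hi.le N⟩⟩

lemma HasFinInjDim.exists_hasInjectiveDimensionLT {A : Type u} [Ring A] {M : ModuleCat.{u} A}
    (h : HasFinInjDim A M) : ∃ d, HasInjectiveDimensionLT M (d + 1) :=
  let ⟨d, h⟩ := h
  ⟨d, HasInjectiveDimensionLT.mk fun i hi Y _ ↦ have := h Y i hi; Subsingleton.elim _ _⟩

lemma LinearMap.exists_comp_eq_of_ker_le {A M N P : Type*} [Ring A] [AddCommGroup M]
    [AddCommGroup N] [AddCommGroup P] [Module A M] [Module A N] [Module A P] {p : M →ₗ[A] N}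
    (hp : Function.Surjective p) {f : M →ₗ[A] P} (h : ker p ≤ ker f) :
    ∃ g : N →ₗ[A] P, g ∘ₗ p = f := by
  refine ⟨Submodule.liftQ _ f h ∘ₗ (p.quotKerEquivOfSurjective hp).symm.toLinearMap, ?_⟩
  ext x
  have : (p.quotKerEquivOfSurjective hp).symm (p x) = Submodule.Quotient.mk x := by
    rw [LinearEquiv.symm_apply_eq]; rfl
  simp only [comp_apply, LinearEquiv.coe_coe, this]
  exact Submodule.liftQ_apply _ _ _

namespace Matrix

open MulOpposite

variable {R : Type u} [Ring R]

/-- The row vector `m * D`, for a row vector `m` with entries in a right module. -/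
def rowAct {M : Type*} [AddCommGroup M] [Module Rᵐᵒᵖ M] {a b : ℕ}
    (m : Fin a → M) (D : Matrix (Fin a) (Fin b) R) : Fin b → M :=
  fun j ↦ ∑ i, op (D i j) • m i

section rowAct

variable {M N : Type*} [AddCommGroup M] [Module Rᵐᵒᵖ M] [AddCommGroup N] [Module Rᵐᵒᵖ N]
  {a b c : ℕ}

lemma rowAct_sub (m n : Fin a → M) (D : Matrix (Fin a) (Fin b) R) :
    rowAct (m - n) D = rowAct m D - rowAct n D := by
  ext j; simp [rowAct, smul_sub]

lemma map_rowAct (f : M →ₗ[Rᵐᵒᵖ] N) (m : Fin a → M) (D : Matrix (Fin a) (Fin b) R) :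
    f ∘ rowAct m D = rowAct (f ∘ m) D := by
  ext j; simp [rowAct]

lemma rowAct_rowAct (m : Fin a → M) (D : Matrix (Fin a) (Fin b) R)
    (E : Matrix (Fin b) (Fin c) R) : rowAct (rowAct m D) E = rowAct m (D * E) := by
  ext j
  simp only [rowAct, Finset.smul_sum, Matrix.mul_apply, Finset.op_sum, Finset.sum_smul,
    smul_smul, op_mul]
  exact Finset.sum_comm

lemma rowAct_zero (m : Fin a → M) : rowAct m (0 : Matrix (Fin a) (Fin b) R) = 0 := by
  ext j; simp [rowAct]

/-- The right linear map from columns to `M` given by multiplication by a row vector over `M`. -/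
def rowHom (m : Fin a → M) : (Fin a → R) →ₗ[Rᵐᵒᵖ] M where
  toFun y := ∑ i, op (y i) • m i
  map_add' y z := by simp [add_smul, Finset.sum_add_distrib]
  map_smul' r y := by simp [Finset.smul_sum, smul_smul]

lemma rowHom_apply (m : Fin a → M) (y : Fin a → R) : rowHom m y = ∑ i, op (y i) • m i := rfl

lemma rowHom_single (m : Fin a → M) (i : Fin a) : rowHom m (Pi.single i (1 : R)) = m i := by
  rw [rowHom_apply, Finset.sum_eq_single i] <;> simp +contextual

lemma rowHom_mulVec (m : Fin a → M) (D : Matrix (Fin a) (Fin b) R) (z : Fin b → R) :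
    rowHom m (D *ᵥ z) = rowHom (rowAct m D) z := by
  simp only [rowHom_apply, rowAct, mulVec, dotProduct, Finset.op_sum, Finset.sum_smul,
    Finset.smul_sum, op_mul, smul_smul]
  exact Finset.sum_comm

lemma eq_rowHom (h : (Fin a → R) →ₗ[Rᵐᵒᵖ] M) : h = rowHom fun i ↦ h (Pi.single i 1) := by
  ext i
  simp [rowHom_single]

/-- Left multiplication by a matrix, as a right linear map on columns. -/
def mulVecRight (D : Matrix (Fin a) (Fin b) R) : (Fin b → R) →ₗ[Rᵐᵒᵖ] (Fin a → R) where
  toFun y := D *ᵥ y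
  map_add' y z := mulVec_add _ _ _
  map_smul' r y := by
    ext i; simp [mulVec, dotProduct, Finset.sum_mul, mul_assoc]

end rowAct

/-- The complex of left modules given by right multiplication by `D'` and then `D` is exact. -/
def RowExact {a b c : ℕ} (D' : Matrix (Fin c) (Fin a) R) (D : Matrix (Fin a) (Fin b) R) : Prop :=
  D' * D = 0 ∧ ∀ x : Fin a → R, x ᵥ* D = 0 → ∃ y, y ᵥ* D' = x

/-- `D` is the end of an exact sequence of `k + 1` matrices. -/
def IsSyz : ℕ → ∀ {a b : ℕ}, Matrix (Fin a) (Fin b) R → Prop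
  | 0, _, _, _ => True
  | k + 1, _, b, D => ∃ (c : ℕ) (E : Matrix (Fin b) (Fin c) R), IsSyz k E ∧ RowExact D E

lemma exists_rowExact [IsNoetherianRing R] {a b : ℕ} (D : Matrix (Fin a) (Fin b) R) :
    ∃ (c : ℕ) (D' : Matrix (Fin c) (Fin a) R), RowExact D' D := by
  obtain ⟨c, s, hs⟩ := Submodule.fg_iff_exists_fin_generating_family.mp
    (IsNoetherian.noetherian (LinearMap.ker D.vecMulLinear))
  have hmem (k : Fin c) : s k ᵥ* D = 0 := by
    have : s k ∈ LinearMap.ker D.vecMulLinear := hs ▸ Submodule.subset_span ⟨k, rfl⟩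
    simpa using this
  refine ⟨c, Matrix.of s, ?_, fun x hx ↦ ?_⟩
  · ext k j
    exact congr_fun (hmem k) j
  · have : x ∈ LinearMap.range (Matrix.of s).vecMulLinear := by
      rw [range_vecMulLinear]
      change x ∈ Submodule.span R (Set.range s)
      rw [hs]
      simpa using hx
    exact this

lemma RowExact.shortExact {a b c : ℕ} {D' : Matrix (Fin c) (Fin a) R}
    {D : Matrix (Fin a) (Fin b) R} (h : RowExact D' D) :
    (ModuleCat.shortComplexOfCompEqZero (LinearMap.range D'.vecMulLinear).subtype
      D.vecMulLinear.rangeRestrict (by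
        ext ⟨_, y, rfl⟩ : 2
        simp [vecMul_vecMul, h.1])).ShortExact := by
  refine ModuleCat.shortComplex_shortExact _ ?_ Subtype.val_injective
    D.vecMulLinear.surjective_rangeRestrict
  intro x
  change D.vecMulLinear.rangeRestrict x = 0 ↔ x ∈ Set.range Subtype.val
  rw [Subtype.range_coe, Subtype.ext_iff]
  refine ⟨fun hx ↦ h.2 x hx, ?_⟩
  rintro ⟨y, rfl⟩
  simp [vecMul_vecMul, h.1]

lemma IsSyz.subsingleton_ext {d : ℕ} (hR : HasInjectiveDimensionLT (ModuleCat.of R R) (d + 1))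
    {k a b : ℕ} {D : Matrix (Fin a) (Fin b) R} (hD : IsSyz k D) (i : ℕ) (hi : d ≤ i + k) :
    Subsingleton (Ext (ModuleCat.of R (LinearMap.range D.vecMulLinear))
      (ModuleCat.of R R) (i + 1)) := by
  induction k generalizing a b i with
  | zero => exact HasInjectiveDimensionLT.subsingleton _ (d + 1) _ (by lia) _
  | succ k ih =>
    obtain ⟨c, E, hE, hDE⟩ := hD
    have : Projective (ModuleCat.of R (Fin b → R)) := inferInstance
    exact hDE.shortExact.subsingleton_ext_X₁ (ih hE (i + 1) (by lia))

lemma IsSyz.exists_mulVec_eq {d : ℕ} (hR : HasInjectiveDimensionLT (ModuleCat.of R R) (d + 1))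
    {a b c : ℕ} {D : Matrix (Fin a) (Fin b) R} (hD : IsSyz (d + 1) D)
    {D' : Matrix (Fin c) (Fin a) R} (h : RowExact D' D) (y : Fin a → R) (hy : D' *ᵥ y = 0) :
    ∃ z, D *ᵥ z = y := by
  obtain ⟨e, E, hE, hDE⟩ := hD
  let φ : (Fin a → R) →ₗ[R] R :=
    { toFun x := x ⬝ᵥ y
      map_add' _ _ := add_dotProduct _ _ _
      map_smul' _ _ := smul_dotProduct _ _ _ }
  have hφ : LinearMap.ker D.vecMulLinear.rangeRestrict ≤ LinearMap.ker φ := by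
    rw [LinearMap.ker_rangeRestrict]
    intro x hx
    obtain ⟨w, rfl⟩ := h.2 x (by simpa using hx)
    change (w ᵥ* D') ⬝ᵥ y = 0
    rw [← dotProduct_mulVec, hy, dotProduct_zero]
  obtain ⟨ψ, hψ⟩ := LinearMap.exists_comp_eq_of_ker_le D.vecMulLinear.surjective_rangeRestrict hφ
  obtain ⟨g, hg⟩ := hDE.shortExact.exists_extension (hE.subsingleton_ext hR 0 (by lia))
    (ModuleCat.ofHom ψ)
  have hg' (x : Fin a → R) : g.hom (x ᵥ* D) = x ⬝ᵥ y :=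
    (LinearMap.congr_fun (congr_arg ModuleCat.Hom.hom hg) (D.vecMulLinear.rangeRestrict x)).trans
      (LinearMap.congr_fun hψ x)
  refine ⟨fun j ↦ g.hom (Pi.single j 1), ?_⟩
  ext i
  have := hg' (Pi.single i 1)
  rw [single_one_dotProduct, single_one_vecMul] at this
  rw [← this]
  have hsum : D.row i = ∑ j, D i j • Pi.single j (1 : R) := by
    ext l; simp [Finset.sum_apply, Pi.single_apply]
  rw [hsum, map_sum]
  simp [mulVec, dotProduct]

end Matrix

section TorVanishing

open MulOpposite Matrix

variable {R : Type u} [Ring R]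

/-- Acyclicity of a right module against finite free resolutions of left modules, in homological
degrees `> k`. When `k = 0` this is a form of the equational criterion of flatness. -/
def TorVanishes (k : ℕ) (M : Type*) [AddCommGroup M] [Module Rᵐᵒᵖ M] : Prop :=
  ∀ ⦃a b c : ℕ⦄ ⦃D' : Matrix (Fin c) (Fin a) R⦄ ⦃D : Matrix (Fin a) (Fin b) R⦄,
    IsSyz k D → RowExact D' D → ∀ m : Fin a → M, rowAct m D = 0 → ∃ m', rowAct m' D' = m

lemma TorVanishes.of_zero {K : Type*} [AddCommGroup K] [Module Rᵐᵒᵖ K]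
    (hK : TorVanishes (R := R) 0 K) (k : ℕ) : TorVanishes (R := R) k K :=
  fun _ _ _ _ _ _ ↦ hK trivial

lemma torVanishes_of_injective {d : ℕ} (hR : HasInjectiveDimensionLT (ModuleCat.of R R) (d + 1))
    (I : Type u) [AddCommGroup I] [Module Rᵐᵒᵖ I] [Module.Injective Rᵐᵒᵖ I] :
    TorVanishes (R := R) (d + 1) I := by
  intro a b c D' D hD h m hm
  have hker : LinearMap.ker (mulVecRight D').rangeRestrict ≤ LinearMap.ker (rowHom m) := by
    rw [LinearMap.ker_rangeRestrict]
    intro y hy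
    obtain ⟨z, rfl⟩ := hD.exists_mulVec_eq hR h y hy
    rw [LinearMap.mem_ker, rowHom_mulVec, hm, rowHom_apply]
    simp
  obtain ⟨f, hf⟩ := LinearMap.exists_comp_eq_of_ker_le
    (mulVecRight D').surjective_rangeRestrict hker
  obtain ⟨g, hg⟩ := Module.Injective.out (Submodule.subtype _) Subtype.val_injective f
  refine ⟨fun k ↦ g (Pi.single k 1), ?_⟩
  have hgm : rowHom (R := R) (rowAct (fun k ↦ g (Pi.single k 1)) D') = rowHom m := by
    refine LinearMap.ext fun y ↦ ?_
    rw [← rowHom_mulVec, ← eq_rowHom g, ← hf]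
    exact hg ((mulVecRight D').rangeRestrict y)
  ext i
  rw [← rowHom_single (R := R) m i, ← hgm, rowHom_single]

lemma torVanishes_finsupp (ι : Type*) : TorVanishes (R := R) 0 (ι →₀ Rᵐᵒᵖ) := by
  classical
  intro a b c D' D _ h m hm
  have hx (s : ι) : (fun i ↦ unop (m i s)) ᵥ* D = 0 := by
    ext j
    have := congr_arg unop (DFunLike.congr_fun (congr_fun hm j) s)
    simpa [rowAct, vecMul, dotProduct, Finsupp.finsetSum_apply, Finset.unop_sum] using this
  choose y hy using fun s ↦ h.2 _ (hx s)
  refine ⟨fun k ↦ Finsupp.onFinset (Finset.univ.biUnion fun i ↦ (m i).support)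
    (fun s ↦ if s ∈ Finset.univ.biUnion (fun i ↦ (m i).support) then op (y s k) else 0)
    (by intro s hs; by_contra h'; exact hs (if_neg h')), ?_⟩
  ext i s
  by_cases hs : s ∈ Finset.univ.biUnion (fun i ↦ (m i).support)
  · have := congr_fun (hy s) i
    apply unop_injective
    simp only [rowAct, Finsupp.finsetSum_apply, Finsupp.smul_apply, Finsupp.onFinset_apply,
      if_pos hs, smul_eq_mul, Finset.unop_sum]
    simpa [vecMul, dotProduct] using this
  · have h0 : m i s = 0 := by
      by_contra h'
      exact hs (Finset.mem_biUnion.mpr ⟨i, Finset.mem_univ _, Finsupp.mem_support_iff.mpr h'⟩)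
    simp only [rowAct, Finsupp.finsetSum_apply, Finsupp.smul_apply, Finsupp.onFinset_apply,
      if_neg hs, h0]
    simp

lemma TorVanishes.ker [IsNoetherianRing R] {P K : Type*} [AddCommGroup P] [Module Rᵐᵒᵖ P]
    [AddCommGroup K] [Module Rᵐᵒᵖ K] {k : ℕ} (hK : TorVanishes (R := R) (k + 1) K)
    (hP : TorVanishes (R := R) 0 P) {f : P →ₗ[Rᵐᵒᵖ] K} (hf : Function.Surjective f) :
    TorVanishes (R := R) k (LinearMap.ker f) := by
  intro a b c D' D hD h m hm
  obtain ⟨p, hp⟩ := hP (D := D) trivial h ((LinearMap.ker f).subtype ∘ m) (by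
    rw [← map_rowAct, hm]; ext; simp)
  obtain ⟨e, D'', h'⟩ := exists_rowExact D'
  obtain ⟨q, hq⟩ := hK (D := D') ⟨_, D, hD, h⟩ h' (f ∘ p) (by
    rw [← map_rowAct, hp]; ext i; exact (m i).2)
  choose p' hp' using fun i ↦ hf (q i)
  have hp'q : f ∘ p' = q := funext hp'
  have hmem (i : Fin c) : (p - rowAct p' D'') i ∈ LinearMap.ker f := by
    have := congr_fun (map_rowAct f p' D'') i
    rw [hp'q, hq] at this
    simpa [sub_eq_zero] using this.symm
  refine ⟨fun i ↦ ⟨_, hmem i⟩, ?_⟩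
  apply (LinearMap.ker f).injective_subtype.comp_left
  change (LinearMap.ker f).subtype ∘ _ = (LinearMap.ker f).subtype ∘ m
  rw [map_rowAct, ← hp]
  change rowAct (p - rowAct p' D'') D' = _
  rw [rowAct_sub, rowAct_rowAct, h'.1, rowAct_zero, sub_zero]

/-- A map from a finitely presented module to a flat module factors through a finite free one. -/
lemma TorVanishes.exists_factorization [IsNoetherianRing R] [IsNoetherianRing Rᵐᵒᵖ]
    {K : Type*} [AddCommGroup K] [Module Rᵐᵒᵖ K] (hK : TorVanishes (R := R) 0 K)
    {X : Type*} [AddCommGroup X] [Module Rᵐᵒᵖ X] [Module.Finite Rᵐᵒᵖ X] (f : X →ₗ[Rᵐᵒᵖ] K) :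
    ∃ (c : ℕ) (g : X →ₗ[Rᵐᵒᵖ] (Fin c → R)) (h : (Fin c → R) →ₗ[Rᵐᵒᵖ] K), h ∘ₗ g = f := by
  obtain ⟨a, s, hs⟩ := Module.Finite.exists_fin (R := Rᵐᵒᵖ) (M := X)
  have hπ : Function.Surjective (rowHom (R := R) s) := by
    rw [← LinearMap.range_eq_top, eq_top_iff, ← hs, Submodule.span_le]
    rintro _ ⟨i, rfl⟩
    exact ⟨Pi.single i 1, rowHom_single s i⟩
  have : Module.Finite Rᵐᵒᵖ R :=
    Module.Finite.equiv (opLinearEquiv Rᵐᵒᵖ : R ≃ₗ[Rᵐᵒᵖ] Rᵐᵒᵖ).symm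
  obtain ⟨b, t, ht⟩ := Submodule.fg_iff_exists_fin_generating_family.mp
    (IsNoetherian.noetherian (LinearMap.ker (rowHom (R := R) s)))
  have hmem (j : Fin b) : rowHom s (t j) = 0 := by
    have : t j ∈ LinearMap.ker (rowHom (R := R) s) := ht ▸ Submodule.subset_span ⟨j, rfl⟩
    simpa using this
  obtain ⟨c, D', h⟩ := exists_rowExact (Matrix.of fun i j ↦ t j i)
  obtain ⟨m', hm'⟩ := hK trivial h (f ∘ s) (by
    rw [← map_rowAct]
    ext j
    exact (congr_arg f (hmem j)).trans (map_zero f))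
  have hker : LinearMap.ker (rowHom (R := R) s) ≤ LinearMap.ker (mulVecRight D') := by
    rw [← ht, Submodule.span_le]
    rintro _ ⟨j, rfl⟩
    ext k
    exact congr_fun (congr_fun h.1 k) j
  obtain ⟨g, hg⟩ := LinearMap.exists_comp_eq_of_ker_le hπ hker
  refine ⟨c, g, rowHom m', LinearMap.ext fun x ↦ ?_⟩
  obtain ⟨y, rfl⟩ := hπ x
  have hy : g (rowHom s y) = D' *ᵥ y := LinearMap.congr_fun hg y
  rw [LinearMap.comp_apply, hy, rowHom_mulVec, hm']
  simp [rowHom_apply]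

end TorVanishing

section Dimension

variable {A : Type u} [Ring A]

lemma hasInjectiveDimensionLT_of_finite {n : ℕ} {K : ModuleCat.{u} A}
    (h : ∀ X : ModuleCat.{u} A, Module.Finite A X → Subsingleton (Ext X K (n + 1))) :
    HasInjectiveDimensionLT K (n + 1) := by
  induction n generalizing K with
  | zero =>
    rw [← injective_iff_hasInjectiveDimensionLT_one]
    suffices Module.Injective A K from Module.injective_object_of_injective_module A K
    refine Module.Baer.injective fun I g ↦ ?_
    have hS := LinearMap.shortExact_shortComplexKer I.mkQ_surjective
    obtain ⟨g', hg'⟩ := hS.exists_extension (h _ inferInstance)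
      (ModuleCat.ofHom (g ∘ₗ (LinearEquiv.ofEq _ _ I.ker_mkQ).toLinearMap))
    refine ⟨g'.hom, fun x hx ↦ ?_⟩
    exact LinearMap.congr_fun (congr_arg ModuleCat.Hom.hom hg') ⟨x, by simpa using hx⟩
  | succ n ih =>
    obtain ⟨p⟩ := EnoughInjectives.presentation K
    have hS : (ShortComplex.mk _ _ (cokernel.condition p.f)).ShortExact :=
      { exact := ShortComplex.exact_cokernel p.f }
    have := p.injective
    exact (hS.hasInjectiveDimensionLT_X₃_iff n p.injective).mp
      (ih fun X hX ↦ hS.subsingleton_ext_cosyzygy (h X hX))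

lemma shortExact_finsupp (M : ModuleCat.{u} A) :
    (Finsupp.linearCombination A (id : M → M)).shortComplexKer.ShortExact :=
  LinearMap.shortExact_shortComplexKer (Finsupp.linearCombination_id_surjective A M)

end Dimension

section NoetherianRing

open MulOpposite Matrix

variable {R : Type u} [Ring R] [IsNoetherianRing R]

lemma TorVanishes.ker_linearCombination {k : ℕ} {K : ModuleCat.{u} Rᵐᵒᵖ}
    (hK : TorVanishes (R := R) (k + 1) K) :
    TorVanishes (R := R) k (Finsupp.linearCombination Rᵐᵒᵖ (id : K → K)).shortComplexKer.X₁ :=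
  hK.ker (torVanishes_finsupp _) (Finsupp.linearCombination_id_surjective Rᵐᵒᵖ K)

lemma TorVanishes.hasProjectiveDimensionLT_of_subsingleton_ext {j : ℕ} {K : ModuleCat.{u} Rᵐᵒᵖ}
    (hK : TorVanishes (R := R) 0 K)
    (h : ∀ Y : ModuleCat.{u} Rᵐᵒᵖ, TorVanishes (R := R) 0 Y → Subsingleton (Ext K Y (j + 1))) :
    HasProjectiveDimensionLT K (j + 1) := by
  have hS := shortExact_finsupp K
  have hK' := (hK.of_zero 1).ker_linearCombination
  have hP : Projective (Finsupp.linearCombination Rᵐᵒᵖ (id : K → K)).shortComplexKer.X₂ :=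
    inferInstanceAs (Projective (ModuleCat.of Rᵐᵒᵖ (K →₀ Rᵐᵒᵖ)))
  induction j generalizing K with
  | zero =>
    exact projective_iff_hasProjectiveDimensionLT_one.mp
      (hS.projective_X₃_of_subsingleton_ext (h _ hK'))
  | succ j ih =>
    exact (hS.hasProjectiveDimensionLT_X₃_iff j hP).mpr
      (ih hK' (fun Y hY ↦ hS.subsingleton_ext_X₁ (h Y hY)) (shortExact_finsupp _)
        (hK'.of_zero 1).ker_linearCombination
        (inferInstanceAs (Projective (ModuleCat.of Rᵐᵒᵖ (_ →₀ Rᵐᵒᵖ)))))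

variable [IsNoetherianRing Rᵐᵒᵖ]

lemma TorVanishes.subsingleton_ext {K : ModuleCat.{u} Rᵐᵒᵖ} (hK : TorVanishes (R := R) 0 K)
    {n : ℕ} (X : ModuleCat.{u} Rᵐᵒᵖ) [Module.Finite Rᵐᵒᵖ X]
    (h : Subsingleton (Ext X (ModuleCat.of Rᵐᵒᵖ R) (n + 1))) :
    Subsingleton (Ext X K (n + 1)) := by
  obtain ⟨a, π, hπ⟩ := Module.Finite.exists_fin' Rᵐᵒᵖ X
  have hS := LinearMap.shortExact_shortComplexKer hπ
  have : Projective π.shortComplexKer.X₂ :=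
    inferInstanceAs (Projective (ModuleCat.of Rᵐᵒᵖ (Fin a → Rᵐᵒᵖ)))
  induction n generalizing X a with
  | zero =>
    refine hS.subsingleton_ext_one_of_exists_extension fun f ↦ ?_
    obtain ⟨c, g, k, hkg⟩ := hK.exists_factorization f.hom
    choose g' hg' using fun i ↦ hS.exists_extension h (ModuleCat.ofHom (LinearMap.proj i ∘ₗ g))
    refine ⟨ModuleCat.ofHom (k ∘ₗ LinearMap.pi fun i ↦ (g' i).hom), ?_⟩
    ext x
    have hx : (fun i ↦ g' i x.1) = g x := funext fun i ↦
      LinearMap.congr_fun (congr_arg ModuleCat.Hom.hom (hg' i)) x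
    exact (congr_arg k hx).trans (LinearMap.congr_fun hkg x)
  | succ n ih =>
    obtain ⟨b, ρ, hρ⟩ := Module.Finite.exists_fin' Rᵐᵒᵖ (LinearMap.ker π)
    exact hS.subsingleton_ext_X₃ (ih (ModuleCat.of Rᵐᵒᵖ (LinearMap.ker π))
      (hS.subsingleton_ext_X₁ h) b ρ hρ (LinearMap.shortExact_shortComplexKer hρ)
      (inferInstanceAs (Projective (ModuleCat.of Rᵐᵒᵖ (Fin b → Rᵐᵒᵖ)))))

variable {n : ℕ}

lemma TorVanishes.hasInjectiveDimensionLT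
    (hn : HasInjectiveDimensionLT (ModuleCat.of Rᵐᵒᵖ R) (n + 1))
    {K : ModuleCat.{u} Rᵐᵒᵖ} (hK : TorVanishes (R := R) 0 K) :
    HasInjectiveDimensionLT K (n + 1) :=
  hasInjectiveDimensionLT_of_finite fun X _ ↦ hK.subsingleton_ext X
    (HasInjectiveDimensionLT.subsingleton _ (n + 1) _ le_rfl X)

lemma TorVanishes.hasProjectiveDimensionLT
    (hn : HasInjectiveDimensionLT (ModuleCat.of Rᵐᵒᵖ R) (n + 1))
    {k : ℕ} {K : ModuleCat.{u} Rᵐᵒᵖ} (hK : TorVanishes (R := R) k K) :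
    HasProjectiveDimensionLT K (k + n + 1) := by
  induction k generalizing K with
  | zero =>
    rw [zero_add]
    exact hK.hasProjectiveDimensionLT_of_subsingleton_ext fun Y hY ↦
      have := hY.hasInjectiveDimensionLT hn
      HasInjectiveDimensionLT.subsingleton Y (n + 1) _ le_rfl K
  | succ k ih =>
    rw [show k + 1 + n + 1 = k + n + 2 by lia]
    exact ((shortExact_finsupp K).hasProjectiveDimensionLT_X₃_iff (k + n)
      (inferInstanceAs (Projective (ModuleCat.of Rᵐᵒᵖ (K →₀ Rᵐᵒᵖ))))).mpr
      (ih hK.ker_linearCombination)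

lemma hasProjectiveDimensionLT_of_hasInjectiveDimensionLT
    (hn : HasInjectiveDimensionLT (ModuleCat.of Rᵐᵒᵖ R) (n + 1))
    {d : ℕ} (hd : HasInjectiveDimensionLT (ModuleCat.of R R) (d + 1))
    {M : ModuleCat.{u} Rᵐᵒᵖ} {k : ℕ} (hM : HasInjectiveDimensionLT M (k + 1)) :
    HasProjectiveDimensionLT M (d + 1 + n + 1) := by
  have key (I : ModuleCat.{u} Rᵐᵒᵖ) (hI : Injective I) :
      HasProjectiveDimensionLT I (d + 1 + n + 1) :=
    have := Module.injective_module_of_injective_object Rᵐᵒᵖ I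
    (torVanishes_of_injective hd I).hasProjectiveDimensionLT hn
  induction k generalizing M with
  | zero => exact key M (injective_iff_hasInjectiveDimensionLT_one.mpr hM)
  | succ k ih =>
    obtain ⟨p⟩ := EnoughInjectives.presentation M
    have hS : (ShortComplex.mk _ _ (cokernel.condition p.f)).ShortExact :=
      { exact := ShortComplex.exact_cokernel p.f }
    have := ih ((hS.hasInjectiveDimensionLT_X₃_iff k p.injective).mpr hM)
    exact hS.hasProjectiveDimensionLT_X₁ _ (key _ p.injective)
      (hasProjectiveDimensionLT_of_ge _ (d + 1 + n + 1) _ (by lia))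

lemma hasInjectiveDimensionLT_of_hasProjectiveDimensionLT
    (hn : HasInjectiveDimensionLT (ModuleCat.of Rᵐᵒᵖ R) (n + 1))
    {M : ModuleCat.{u} Rᵐᵒᵖ} {k : ℕ} (hM : HasProjectiveDimensionLT M (k + 1)) :
    HasInjectiveDimensionLT M (n + 1) := by
  have hS := shortExact_finsupp M
  have hP := (torVanishes_finsupp (R := R) M).hasInjectiveDimensionLT (n := n)
    (K := ModuleCat.of Rᵐᵒᵖ (M →₀ Rᵐᵒᵖ)) hn
  induction k generalizing M with
  | zero =>
    have : Projective M := projective_iff_hasProjectiveDimensionLT_one.mpr hM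
    have := hS.epi_g
    have r : Retract M (ModuleCat.of Rᵐᵒᵖ (M →₀ Rᵐᵒᵖ)) :=
      ⟨Projective.factorThru (𝟙 M) (ModuleCat.ofHom (Finsupp.linearCombination Rᵐᵒᵖ id)),
        ModuleCat.ofHom (Finsupp.linearCombination Rᵐᵒᵖ id), Projective.factorThru_comp _ _⟩
    exact r.hasInjectiveDimensionLT (n + 1)
  | succ k ih =>
    have := ih ((hS.hasProjectiveDimensionLT_X₃_iff k
      (inferInstanceAs (Projective (ModuleCat.of Rᵐᵒᵖ (M →₀ Rᵐᵒᵖ))))).mp hM)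
      (shortExact_finsupp _) ((torVanishes_finsupp (R := R) _).hasInjectiveDimensionLT hn)
    exact hS.hasInjectiveDimensionLT_X₃ (n + 1) hP
      (hasInjectiveDimensionLT_of_ge _ (n + 1) _ (by lia))

end NoetherianRing

lemma IsGorensteinRing.exists_hasProjectiveDimensionLT_iff {R : Type u} [Ring R]
    (hR : IsGorensteinRing R) (M : ModuleCat.{u} Rᵐᵒᵖ) :
    (∃ d, HasProjectiveDimensionLT M d) ↔ ∃ d, HasInjectiveDimensionLT M d := by
  obtain ⟨_, _, hr, hl⟩ := hR
  obtain ⟨n, hn⟩ := hr.exists_hasInjectiveDimensionLT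
  obtain ⟨d, hd⟩ := hl.exists_hasInjectiveDimensionLT
  refine ⟨fun ⟨k, hk⟩ ↦ ⟨n + 1, ?_⟩, fun ⟨k, hk⟩ ↦ ⟨d + 1 + n + 1, ?_⟩⟩
  · exact hasInjectiveDimensionLT_of_hasProjectiveDimensionLT hn
      (hasProjectiveDimensionLT_of_ge M k (k + 1) k.le_succ)
  · exact hasProjectiveDimensionLT_of_hasInjectiveDimensionLT hn hd
      (hasInjectiveDimensionLT_of_ge M k (k + 1) k.le_succ)

theorem finProjDim_iff_of_fullyFaithful_left_adjoint_exact
    {R S : Type u} [Ring R] [Ring S]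
    (hR : IsGorensteinRing R) (hS : IsGorensteinRing S)
    (L : ModuleCat.{u} Rᵐᵒᵖ ⥤ ModuleCat.{u} Sᵐᵒᵖ)
    (G : ModuleCat.{u} Sᵐᵒᵖ ⥤ ModuleCat.{u} Rᵐᵒᵖ)
    (R' : ModuleCat.{u} Rᵐᵒᵖ ⥤ ModuleCat.{u} Sᵐᵒᵖ)
    [L.Additive] [G.Additive] [R'.Additive]
    (adj₁ : L ⊣ G) (adj₂ : G ⊣ R')
    [G.Full] [G.Faithful]
    [PreservesFiniteLimits L] [PreservesFiniteColimits L]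
    (m : ModuleCat.{u} Sᵐᵒᵖ) :
    HasFinProjDim Sᵐᵒᵖ m ↔ HasFinProjDim Rᵐᵒᵖ (G.obj m) := by
  have : PreservesFiniteLimits G := have := adj₁.rightAdjoint_preservesLimits; inferInstance
  have : PreservesFiniteColimits G := have := adj₂.leftAdjoint_preservesColimits; inferInstance
  rw [hasFinProjDim_iff, hasFinProjDim_iff]
  constructor
  · rw [hS.exists_hasProjectiveDimensionLT_iff, hR.exists_hasProjectiveDimensionLT_iff]
    exact fun ⟨d, hd⟩ ↦
      ⟨d, hasInjectiveDimensionLT_map_of_exact G (fun _ ↦ adj₁.map_injective _) hd⟩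
  · rintro ⟨d, hd⟩
    have : HasProjectiveDimensionLT ((G ⋙ L).obj m) d :=
      hasProjectiveDimensionLT_map_of_exact L (fun _ ↦ adj₁.map_projective _) hd
    exact ⟨d, hasProjectiveDimensionLT_of_iso (asIso (adj₁.counit.app m)) d⟩
end

section
/- Under the Setup, for every right R-module m and every integer j ≥ 0 there is an isomorphism of abelian groups R^j R′(m) ≅ Ext^j_R(G(S), m), natural in m, where G(S) denotes G applied to the right regular S-module. -/
/-!
Statement 5: Under the Setup (R, S Gorenstein rings, adjoint triple L ⊣ G ⊣ R′ of additive
functors between the categories of right modules, with G fully faithful and L exact), for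
every right R-module m and every j ≥ 0 there is an isomorphism of abelian groups
R^j R′(m) ≅ Ext^j_R(G(S), m), natural in m, where G(S) is G applied to the right regular
S-module.  Right A-modules are formalized as objects of `ModuleCat Aᵐᵒᵖ`; `R^j R′` is the
classical right derived functor `R'.rightDerived j`; naturality in m is expressed by the
compatibility of the isomorphisms with the maps induced by any morphism m ⟶ m′.
-/

open CategoryTheory CategoryTheory.Abelian CategoryTheory.Limits

universe u

namespace CategoryTheory.InjectiveResolution

universe w v₁ u₁

lemma extMk_eq_zero_iff_exists_prev {C : Type u₁} [Category.{v₁} C] [Abelian C] [HasExt.{w} C]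
    {X Y : C} (I : InjectiveResolution Y) {n : ℕ} (f : X ⟶ I.cocomplex.X n)
    (m : ℕ) (hm : n + 1 = m) (hf : f ≫ I.cocomplex.d n m = 0) :
    I.extMk f m hm hf = 0 ↔
      ∃ g : X ⟶ I.cocomplex.X ((ComplexShape.up ℕ).prev n), g ≫ I.cocomplex.d _ n = f := by
  cases n with
  | succ p => exact I.extMk_eq_zero_iff f m hm hf _ (by simp)
  | zero =>
    have hd : I.cocomplex.d ((ComplexShape.up ℕ).prev 0) 0 = 0 :=
      I.cocomplex.shape _ _ (by simp)
    rw [hd]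
    simp only [comp_zero, exists_const]
    refine ⟨fun h ↦ ?_, by rintro rfl; simp⟩
    rw [← I.extEquivCohomologyClass.apply_eq_iff_eq, extEquivCohomologyClass_extMk,
      extEquivCohomologyClass_zero, CochainComplex.HomComplex.CohomologyClass.mk_eq_zero_iff,
      CochainComplex.HomComplex.Cocycle.fromSingleMk_mem_coboundaries_iff _ _ _ _ _ (-1)
        (by simp)] at h
    obtain ⟨g, hg⟩ := h
    have hg₀ : g = 0 :=
      (CochainComplex.isZero_of_isStrictlyGE I.cochainComplex 0 (-1) (by simp)).eq_of_tgt _ _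
    rw [← cancel_mono (I.cochainComplexXIso ((0 : ℕ) : ℤ) 0 rfl).inv, ← hg, hg₀]
    simp

end CategoryTheory.InjectiveResolution

namespace HomologicalComplex

lemma homologyπ_apply_eq_zero_iff {A : Type*} [Ring A] {ι : Type*} {c : ComplexShape ι}
    (K : HomologicalComplex (ModuleCat A) c) (j : ι) (z : K.cycles j) :
    K.homologyπ j z = 0 ↔ ∃ b : K.X (c.prev j), K.d _ j b = K.iCycles j z := by
  have hexact : (ShortComplex.mk _ _ (K.toCycles_comp_homologyπ (c.prev j) j)).Exact :=
    ShortComplex.exact_of_g_is_cokernel _ (K.homologyIsCokernel _ j rfl)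
  rw [ShortComplex.moduleCat_exact_iff] at hexact
  have hi : Function.Injective (K.iCycles j) :=
    (ModuleCat.mono_iff_injective _).1 inferInstance
  constructor
  · intro hz
    obtain ⟨b, rfl⟩ := hexact z hz
    exact ⟨b, by simp [← ConcreteCategory.comp_apply]⟩
  · rintro ⟨b, hb⟩
    obtain rfl : K.toCycles (c.prev j) j b = z :=
      hi (by rw [← hb, ← ConcreteCategory.comp_apply, K.toCycles_i])
    rw [← ConcreteCategory.comp_apply, K.toCycles_comp_homologyπ]
    rfl

end HomologicalComplex

/-- Two surjective additive maps with the same kernel have isomorphic targets. -/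
lemma AddMonoidHom.exists_addEquiv_of_ker_eq {Z H E : Type*} [AddCommGroup Z] [AddCommGroup H]
    [AddCommGroup E] (π : Z →+ H) (φ : Z →+ E) (hπ : Function.Surjective π)
    (hφ : Function.Surjective φ) (h : π.ker = φ.ker) :
    ∃ e : H ≃+ E, ∀ z, e (π z) = φ z := by
  let e₁ := QuotientAddGroup.quotientKerEquivOfSurjective π hπ
  let e₂ := QuotientAddGroup.quotientKerEquivOfSurjective φ hφ
  refine ⟨e₁.symm.trans ((QuotientAddGroup.quotientAddEquivOfEq h).trans e₂), fun z ↦ ?_⟩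
  have hz : e₁.symm (π z) = (z : Z ⧸ π.ker) := by
    rw [AddEquiv.symm_apply_eq]
    rfl
  simp only [AddEquiv.trans_apply, hz]
  rfl

section Corepresented

universe w v₁ u₁ u₂ v₂

variable {C : Type u₁} [Category.{v₁} C] [Abelian C] [HasExt.{w} C]
  {A : Type u₂} [Ring A] (F : C ⥤ ModuleCat.{v₂} A) [F.Additive] {X : C}
  (η : ∀ Y : C, F.obj Y ≃+ (X ⟶ Y))

/-- An injective resolution `I` of `Y` computes `Ext X Y j` as the homology of `F` applied to `I`,
when `F` is corepresented by `X` on underlying abelian groups. -/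
lemma exists_homology_addEquiv_ext
    (hη : ∀ (Y Y' : C) (f : Y ⟶ Y') (y : F.obj Y), η Y' (F.map f y) = η Y y ≫ f)
    {Y : C} (I : InjectiveResolution Y) (j : ℕ) :
    ∃ e : ((F.mapHomologicalComplex (ComplexShape.up ℕ)).obj I.cocomplex).homology j ≃+
        Ext X Y j,
      ∀ z : ((F.mapHomologicalComplex (ComplexShape.up ℕ)).obj I.cocomplex).cycles j,
        ∃ h : η _ (((F.mapHomologicalComplex (ComplexShape.up ℕ)).obj I.cocomplex).iCycles j z) ≫
          I.cocomplex.d j (j + 1) = 0,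
        e (((F.mapHomologicalComplex (ComplexShape.up ℕ)).obj I.cocomplex).homologyπ j z) =
          I.extMk (η _ (((F.mapHomologicalComplex
            (ComplexShape.up ℕ)).obj I.cocomplex).iCycles j z)) (j + 1) rfl h := by
  let K := (F.mapHomologicalComplex (ComplexShape.up ℕ)).obj I.cocomplex
  have hcyc (z : K.cycles j) : η _ (K.iCycles j z) ≫ I.cocomplex.d j (j + 1) = 0 := by
    have h0 : K.d j (j + 1) (K.iCycles j z) = 0 := by
      rw [← ConcreteCategory.comp_apply, K.iCycles_d]
      rfl
    exact (hη _ _ _ _).symm.trans <| (congrArg (η _) h0).trans (map_zero _)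
  let φ : K.cycles j →+ Ext X Y j := AddMonoidHom.mk'
    (fun z ↦ I.extMk (η _ (K.iCycles j z)) (j + 1) rfl (hcyc z)) (fun z z' ↦ by
      rw [InjectiveResolution.add_extMk]
      congr 1
      rw [map_add]
      exact map_add (η _) _ _)
  have hφ : Function.Surjective φ := by
    intro α
    obtain ⟨f, hf, rfl⟩ := I.extMk_surjective α (j + 1) rfl
    have hcy : K.d j (j + 1) ((η _).symm f) = 0 := by
      apply (η _).injective
      refine (hη _ _ (I.cocomplex.d j (j + 1)) _).trans ?_
      rw [AddEquiv.apply_symm_apply, hf]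
      exact (map_zero (η _)).symm
    have hexact : (ShortComplex.mk _ _ (K.iCycles_d j (j + 1))).Exact :=
      ShortComplex.exact_of_f_is_kernel _ (K.cyclesIsKernel j (j + 1) (by simp))
    rw [ShortComplex.moduleCat_exact_iff] at hexact
    obtain ⟨z, hz⟩ := hexact _ hcy
    refine ⟨z, ?_⟩
    change I.extMk (η _ (K.iCycles j z)) (j + 1) rfl (hcyc z) = I.extMk f (j + 1) rfl hf
    congr 1
    exact (congrArg (η _) hz).trans (AddEquiv.apply_symm_apply _ _)
  obtain ⟨e, he⟩ := AddMonoidHom.exists_addEquiv_of_ker_eq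
    (K.homologyπ j).hom.toAddMonoidHom φ ((ModuleCat.epi_iff_surjective _).1 inferInstance) hφ (by
      ext z
      refine (K.homologyπ_apply_eq_zero_iff j z).trans (Iff.trans ?_
        (I.extMk_eq_zero_iff_exists_prev _ (j + 1) rfl (hcyc z)).symm)
      constructor
      · rintro ⟨b, hb⟩
        exact ⟨η _ b, (hη _ _ _ b).symm.trans (congrArg (η _) hb)⟩
      · rintro ⟨g, hg⟩
        refine ⟨(η _).symm g, (η _).injective ((hη _ _ _ _).trans ?_)⟩
        rw [AddEquiv.apply_symm_apply, hg])
  exact ⟨e, fun z ↦ ⟨hcyc z, he z⟩⟩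

/-- If `F` is corepresented by `X` on underlying abelian groups, then its right derived functors
are naturally isomorphic to `Ext X`. -/
theorem exists_rightDerived_addEquiv_ext [HasInjectiveResolutions C]
    (hη : ∀ (Y Y' : C) (f : Y ⟶ Y') (y : F.obj Y), η Y' (F.map f y) = η Y y ≫ f) (j : ℕ) :
    ∃ e : ∀ Y : C, (F.rightDerived j).obj Y ≃+ Ext X Y j,
      ∀ (Y Y' : C) (f : Y ⟶ Y') (y : (F.rightDerived j).obj Y),
        e Y' ((F.rightDerived j).map f y) = (e Y y).comp (Ext.mk₀ f) (add_zero j) := by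
  let I (Y : C) : InjectiveResolution Y := injectiveResolution Y
  let K (Y : C) := (F.mapHomologicalComplex (ComplexShape.up ℕ)).obj (I Y).cocomplex
  choose e he using fun Y : C ↦ exists_homology_addEquiv_ext F η hη (I Y) j
  let i (Y : C) : (F.rightDerived j).obj Y ≅ (K Y).homology j := (I Y).isoRightDerivedObj F j
  refine ⟨fun Y ↦ (i Y).toLinearEquiv.toAddEquiv.trans (e Y), fun Y Y' f y ↦ ?_⟩
  let φ : InjectiveResolution.Hom (I Y) (I Y') f :=
    { hom := InjectiveResolution.desc f (I Y') (I Y)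
      ι_f_zero_comp_hom_f_zero :=
        (InjectiveResolution.desc_commutes_zero f _ _).trans (by simp) }
  let ψ : K Y ⟶ K Y' := (F.mapHomologicalComplex (ComplexShape.up ℕ)).map φ.hom
  have hnat : (F.rightDerived j).map f ≫ (i Y').hom =
      (i Y).hom ≫ HomologicalComplex.homologyMap ψ j :=
    InjectiveResolution.isoRightDerivedObj_hom_naturality f (I Y) (I Y') φ.hom
      (InjectiveResolution.desc_commutes_zero f _ _) F j
  obtain ⟨z, hz⟩ : ∃ z, (K Y).homologyπ j z = (i Y).hom y :=
    (ModuleCat.epi_iff_surjective _).1 inferInstance _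
  have hι : (K Y').iCycles j (HomologicalComplex.cyclesMap ψ j z) =
      F.map (φ.hom.f j) ((K Y).iCycles j z) := by
    rw [← ConcreteCategory.comp_apply, HomologicalComplex.cyclesMap_i]
    rfl
  have hπ : (i Y').hom ((F.rightDerived j).map f y) =
      (K Y').homologyπ j (HomologicalComplex.cyclesMap ψ j z) := by
    rw [← ConcreteCategory.comp_apply, hnat, ConcreteCategory.comp_apply, ← hz,
      ← ConcreteCategory.comp_apply, ← ConcreteCategory.comp_apply,
      HomologicalComplex.homologyπ_naturality]
  change e Y' ((i Y').hom ((F.rightDerived j).map f y)) =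
    (e Y ((i Y).hom y)).comp (Ext.mk₀ f) (add_zero j)
  obtain ⟨h, hez⟩ := he Y z
  obtain ⟨h', hez'⟩ := he Y' (HomologicalComplex.cyclesMap ψ j z)
  rw [hπ, ← hz, hez, hez', InjectiveResolution.extMk_comp_mk₀ _ _ _ _ φ]
  congr 1
  exact (congrArg (η _) hι).trans (hη _ _ _ _)

end Corepresented

/-- Evaluation at `1` on morphisms out of the right regular module. -/
def rightRegularHomAddEquiv {S : Type u} [Ring S] (M : ModuleCat.{u} Sᵐᵒᵖ) :
    (ModuleCat.of Sᵐᵒᵖ S ⟶ M) ≃+ M where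
  toFun f := f.hom (1 : S)
  invFun x := ModuleCat.ofHom
    { toFun := fun s : S ↦ MulOpposite.op s • x
      map_add' := fun s t ↦ by rw [MulOpposite.op_add, add_smul]
      map_smul' := fun r s ↦ by simp [MulOpposite.smul_eq_mul_unop, mul_smul] }
  left_inv f := by
    ext
    simp
  right_inv x := by simp
  map_add' _ _ := rfl

theorem rightDerived_iso_ext_of_fullyFaithful_left_adjoint_exact
    {R S : Type u} [Ring R] [Ring S]
    (hR : IsGorensteinRing R) (hS : IsGorensteinRing S)
    (L : ModuleCat.{u} Rᵐᵒᵖ ⥤ ModuleCat.{u} Sᵐᵒᵖ)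
    (G : ModuleCat.{u} Sᵐᵒᵖ ⥤ ModuleCat.{u} Rᵐᵒᵖ)
    (R' : ModuleCat.{u} Rᵐᵒᵖ ⥤ ModuleCat.{u} Sᵐᵒᵖ)
    [L.Additive] [G.Additive] [R'.Additive]
    (adj₁ : L ⊣ G) (adj₂ : G ⊣ R')
    [G.Full] [G.Faithful]
    [PreservesFiniteLimits L] [PreservesFiniteColimits L]
    (j : ℕ) :
    ∃ e : ∀ m : ModuleCat.{u} Rᵐᵒᵖ,
        ((R'.rightDerived j).obj m) ≃+ Ext (G.obj (ModuleCat.of Sᵐᵒᵖ S)) m j,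
      ∀ (m m' : ModuleCat.{u} Rᵐᵒᵖ) (f : m ⟶ m') (y : (R'.rightDerived j).obj m),
        e m' (((R'.rightDerived j).map f) y) = (e m y).comp (Ext.mk₀ f) (add_zero j) := by
  let η (m : ModuleCat.{u} Rᵐᵒᵖ) : R'.obj m ≃+ (G.obj (ModuleCat.of Sᵐᵒᵖ S) ⟶ m) :=
    (rightRegularHomAddEquiv (R'.obj m)).symm.trans (adj₂.homAddEquiv _ m).symm
  refine exists_rightDerived_addEquiv_ext R' η (fun m m' f y ↦ ?_) j
  obtain ⟨g, rfl⟩ := (rightRegularHomAddEquiv (R'.obj m)).surjective y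
  have hg : R'.map f (rightRegularHomAddEquiv (R'.obj m) g) =
      rightRegularHomAddEquiv (R'.obj m') (g ≫ R'.map f) := rfl
  simp [η, hg, adj₂.homEquiv_naturality_right_symm]
end

section
/- Under the Setup, every Gorenstein injective right R-module is acyclic for R′: if m is a Gorenstein injective right R-module, then R^j R′(m) = 0 for all j > 0. -/
/-!
Statement 7: Under the Setup (R, S Gorenstein rings, adjoint triple L ⊣ G ⊣ R′ of additive
functors between the categories of right modules, with G fully faithful and L exact), every
Gorenstein injective right R-module m is acyclic for R′: R^j R′(m) = 0 for all j > 0.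
Right A-modules are formalized as objects of `ModuleCat Aᵐᵒᵖ`; Gorenstein injectivity is
expressed by the vanishing of Ext^i(E, −) for i ≥ 1 against all modules E of finite
injective dimension.
-/

open CategoryTheory CategoryTheory.Abelian CategoryTheory.Limits

universe u

/-- `M` is Gorenstein injective: `Ext^i(E, M) = 0` for all `i ≥ 1` and all modules `E`
of finite injective dimension. -/
def IsGorensteinInjective (A : Type u) [Ring A] (M : ModuleCat.{u} A) : Prop :=
  ∀ E : ModuleCat.{u} A, HasFinInjDim A E → ∀ i : ℕ, 1 ≤ i → Subsingleton (Ext E M i)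

/-- An exact functor preserving injective objects does not increase injective dimension. -/
lemma CategoryTheory.Functor.hasInjectiveDimensionLT_obj {C D : Type*} [Category* C] [Abelian C]
    [Category* D] [Abelian D] [EnoughInjectives C] (F : C ⥤ D) [F.Additive]
    [PreservesFiniteLimits F] [PreservesFiniteColimits F] [F.PreservesInjectiveObjects]
    (n : ℕ) (X : C) [HasInjectiveDimensionLT X n] : HasInjectiveDimensionLT (F.obj X) n := by
  induction n generalizing X with
  | zero =>
    exact (F.map_isZero (isZero_of_hasInjectiveDimensionLT_zero X)).hasInjectiveDimensionLT_zero
  | succ n ih =>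
    obtain _ | n := n
    · have : Injective X := injective_iff_hasInjectiveDimensionLT_one.2 ‹_›
      exact injective_iff_hasInjectiveDimensionLT_one.1 (F.injective_obj X)
    let T : ShortComplex C := ShortComplex.mk (Injective.ι X) (cokernel.π _)
      (cokernel.condition _)
    have hT : T.ShortExact := { exact := ShortComplex.exact_cokernel _ }
    have h₃ : HasInjectiveDimensionLT T.X₃ (n + 1) :=
      (hT.hasInjectiveDimensionLT_X₃_iff n (inferInstanceAs (Injective (Injective.under X)))).2 ‹_›
    exact ((hT.map_of_exact F).hasInjectiveDimensionLT_X₃_iff n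
      (inferInstanceAs (Injective (F.obj (Injective.under X))))).1 (ih T.X₃)

lemma hasFinInjDim_iff (A : Type u) [Ring A] (M : ModuleCat.{u} A) :
    HasFinInjDim A M ↔ ∃ n, HasInjectiveDimensionLT M n := by
  constructor
  · rintro ⟨d, hd⟩
    exact ⟨d + 1, .mk fun i hi N e ↦ (hd N i hi).elim _ _⟩
  · rintro ⟨n, _⟩
    exact ⟨n, fun N i hi ↦ HasInjectiveDimensionLT.subsingleton M n i hi.le N⟩

/-- The morphism of right modules from the ring to `M` sending `1` to `x`. -/
def ModuleCat.homOfElement {A : Type u} [Ring A] {M : ModuleCat.{u} Aᵐᵒᵖ} (x : M) :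
    ModuleCat.of Aᵐᵒᵖ A ⟶ M :=
  ModuleCat.ofHom
    { toFun a := MulOpposite.op a • x
      map_add' a b := by simp [add_smul]
      map_smul' a b := by simp [mul_smul] }

@[simp]
lemma ModuleCat.homOfElement_apply {A : Type u} [Ring A] {M : ModuleCat.{u} Aᵐᵒᵖ} (x : M)
    (a : A) : (ModuleCat.homOfElement x).hom a = MulOpposite.op a • x := rfl

/-- Exactness of a complex of right modules can be tested on morphisms from the ring. -/
lemma ModuleCat.exact_of_lift_of_ring {A : Type u} [Ring A] (T : ShortComplex (ModuleCat.{u} Aᵐᵒᵖ))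
    (h : ∀ f : ModuleCat.of Aᵐᵒᵖ A ⟶ T.X₂, f ≫ T.g = 0 →
      ∃ g : ModuleCat.of Aᵐᵒᵖ A ⟶ T.X₁, g ≫ T.f = f) : T.Exact := by
  rw [ShortComplex.moduleCat_exact_iff]
  intro x hx
  obtain ⟨g, hg⟩ := h (ModuleCat.homOfElement x) (by
    refine ModuleCat.hom_ext (LinearMap.ext fun a ↦ ?_)
    change T.g.hom (MulOpposite.op a • x) = 0
    rw [map_smul, show T.g.hom x = 0 from hx, smul_zero])
  refine ⟨g.hom (1 : A), ?_⟩
  calc T.f.hom (g.hom (1 : A)) = (g ≫ T.f).hom (1 : A) := rfl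
    _ = x := by rw [hg, ModuleCat.homOfElement_apply, MulOpposite.op_one, one_smul]

/-- If `F ⊣ H` and `Ext^j(F(A), M) = 0` for a positive `j`, then the `j`-th right derived functor
of `H` vanishes at `M`. -/
lemma isZero_rightDerived_obj_of_subsingleton_ext {A : Type u} [Ring A] {C : Type*} [Category* C]
    [Abelian C] [HasExt C] [HasInjectiveResolutions C] {F : ModuleCat.{u} Aᵐᵒᵖ ⥤ C}
    {H : C ⥤ ModuleCat.{u} Aᵐᵒᵖ} [F.Additive] [H.Additive] (adj : F ⊣ H) (M : C) (n : ℕ)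
    [Subsingleton (Ext (F.obj (ModuleCat.of Aᵐᵒᵖ A)) M (n + 1))] :
    IsZero ((H.rightDerived (n + 1)).obj M) := by
  let I := injectiveResolution M
  refine IsZero.of_iso ?_ (I.isoRightDerivedObj H (n + 1))
  refine (HomologicalComplex.exactAt_iff_isZero_homology _ _).1 ?_
  rw [HomologicalComplex.exactAt_iff' _ n (n + 1) (n + 2) (by simp) (by simp)]
  refine ModuleCat.exact_of_lift_of_ring _
    fun (f : ModuleCat.of Aᵐᵒᵖ A ⟶ H.obj (I.cocomplex.X (n + 1)))
      (hf : f ≫ H.map (I.cocomplex.d (n + 1) (n + 2)) = 0) ↦ ?_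
  have hf' : (adj.homEquiv _ _).symm f ≫ I.cocomplex.d (n + 1) (n + 2) = 0 := by
    rw [← adj.homEquiv_naturality_right_symm, hf]
    simp [adj.homEquiv_counit]
  obtain ⟨g, hg⟩ := (I.extMk_eq_zero_iff _ (n + 2) rfl hf' n rfl).1 (Subsingleton.elim _ _)
  have hg' : adj.homEquiv _ _ g ≫ H.map (I.cocomplex.d n (n + 1)) = f := by
    rw [← adj.homEquiv_naturality_right, hg, Equiv.apply_symm_apply]
  exact ⟨adj.homEquiv _ _ g, hg'⟩

theorem gorensteinInjective_acyclic_for_right_adjoint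
    {R S : Type u} [Ring R] [Ring S]
    (hR : IsGorensteinRing R) (hS : IsGorensteinRing S)
    (L : ModuleCat.{u} Rᵐᵒᵖ ⥤ ModuleCat.{u} Sᵐᵒᵖ)
    (G : ModuleCat.{u} Sᵐᵒᵖ ⥤ ModuleCat.{u} Rᵐᵒᵖ)
    (R' : ModuleCat.{u} Rᵐᵒᵖ ⥤ ModuleCat.{u} Sᵐᵒᵖ)
    [L.Additive] [G.Additive] [R'.Additive]
    (adj₁ : L ⊣ G) (adj₂ : G ⊣ R')
    [G.Full] [G.Faithful]
    [PreservesFiniteLimits L] [PreservesFiniteColimits L]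
    (m : ModuleCat.{u} Rᵐᵒᵖ) (hm : IsGorensteinInjective Rᵐᵒᵖ m)
    (j : ℕ) (hj : 0 < j) :
    IsZero ((R'.rightDerived j).obj m) := by
  have : PreservesLimits G := adj₁.rightAdjoint_preservesLimits
  have : PreservesColimits G := adj₂.leftAdjoint_preservesColimits
  have : G.PreservesInjectiveObjects :=
    Functor.preservesInjectiveObjects_of_adjunction_of_preservesMonomorphisms adj₁
  obtain ⟨d, _⟩ := (hasFinInjDim_iff _ _).1 hS.2.2.1
  have := hm (G.obj (ModuleCat.of Sᵐᵒᵖ S))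
    ((hasFinInjDim_iff _ _).2 ⟨d, G.hasInjectiveDimensionLT_obj d _⟩) j hj
  obtain ⟨n, rfl⟩ := Nat.exists_eq_succ_of_ne_zero hj.ne'
  exact isZero_rightDerived_obj_of_subsingleton_ext adj₂ m n
end

section
/- Under the Setup, a right R-module m is R′-acyclic (i.e. R^j R′(m) = 0 for all j > 0) if and only if for every right S-module n and every integer j ≥ 0 there is an isomorphism of abelian groups Ext^j_R(G(n), m) ≅ Ext^j_S(n, R′(m)). -/
/-!
Statement 8: Under the Setup (R, S Gorenstein rings, adjoint triple L ⊣ G ⊣ R′ of additive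
functors between the categories of right modules, with G fully faithful and L exact), a right
R-module m is R′-acyclic (R^j R′(m) = 0 for all j > 0) if and only if for every right
S-module n and every j ≥ 0 there is an isomorphism of abelian groups
Ext^j_R(G(n), m) ≅ Ext^j_S(n, R′(m)).
Right A-modules are formalized as objects of `ModuleCat Aᵐᵒᵖ`.
-/

open CategoryTheory CategoryTheory.Abelian CategoryTheory.Limits

universe u

namespace CategoryTheory.InjectiveResolution

variable {C : Type*} [Category* C] [Abelian C]

/-- The degree `n` cocycles of the complex `Hom(X, K)`. -/
def homCocycles (X : C) (K : CochainComplex C ℕ) (n : ℕ) : AddSubgroup (X ⟶ K.X n) where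
  carrier := {f | f ≫ K.d n (n + 1) = 0}
  zero_mem' := by simp
  add_mem' {a b} ha hb := by
    simp only [Set.mem_ofPred_eq] at ha hb ⊢
    simp [ha, hb]
  neg_mem' {a} ha := by
    simp only [Set.mem_ofPred_eq] at ha ⊢
    simp [ha]

/-- The class in `Ext X Y n` of a cocycle with values in an injective resolution of `Y`. -/
noncomputable def extMkHom [HasExt C] {Y : C} (I : InjectiveResolution Y) (X : C) (n : ℕ) :
    homCocycles X I.cocomplex n →+ Abelian.Ext X Y n where
  toFun f := I.extMk f.1 (n + 1) rfl f.2
  map_zero' := I.extMk_zero _ _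
  map_add' f g := (I.add_extMk f.1 g.1 (n + 1) rfl f.2 g.2).symm

lemma extMkHom_surjective [HasExt C] {Y : C} (I : InjectiveResolution Y) (X : C) (n : ℕ) :
    Function.Surjective (I.extMkHom X n) := fun α ↦ by
  obtain ⟨f, hf, rfl⟩ := I.extMk_surjective α (n + 1) rfl
  exact ⟨⟨f, hf⟩, rfl⟩

lemma mem_ker_extMkHom_iff [HasExt C] {Y : C} (I : InjectiveResolution Y) (X : C) (n : ℕ)
    (f : homCocycles X I.cocomplex (n + 1)) :
    f ∈ (I.extMkHom X (n + 1)).ker ↔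
      ∃ g : X ⟶ I.cocomplex.X n, g ≫ I.cocomplex.d n (n + 1) = f.1 :=
  I.extMk_eq_zero_iff f.1 (n + 2) rfl f.2 n rfl

variable {D : Type*} [Category* D] [Abelian D]

lemma map_ι_f_zero_comp_map_d {Y : C} (I : InjectiveResolution Y) (F : C ⥤ D) [F.Additive] :
    F.map (I.ι.f 0) ≫ F.map (I.cocomplex.d 0 1) = 0 := by
  rw [← F.map_comp, I.ι_f_zero_comp_complex_d, F.map_zero]

/-- The image of an injective resolution of `Y` under a left exact functor `F` which preserves
injective objects is an injective resolution of `F.obj Y` if `F` preserves its exactness in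
positive degrees. -/
noncomputable def mapOfExactAt {Y : C} (I : InjectiveResolution Y) (F : C ⥤ D) [F.Additive]
    [PreservesFiniteLimits F] (hinj : ∀ X : C, Injective X → Injective (F.obj X))
    (hF : ∀ n, ((F.mapHomologicalComplex _).obj I.cocomplex).ExactAt (n + 1)) :
    InjectiveResolution (F.obj Y) where
  cocomplex := (F.mapHomologicalComplex _).obj I.cocomplex
  injective n := hinj _ (I.injective n)
  ι := (CochainComplex.fromSingle₀Equiv _ _).symm ⟨F.map (I.ι.f 0),
    I.map_ι_f_zero_comp_map_d F⟩
  quasiIso := ⟨fun n ↦ by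
    cases n with
    | zero =>
      rw [CochainComplex.quasiIsoAt₀_iff, ShortComplex.quasiIso_iff_of_zeros _ rfl rfl
        (((F.mapHomologicalComplex _).obj I.cocomplex).shape 0 0 (by simp))]
      have h := ShortComplex.exact_and_mono_f_iff_f_is_kernel
        (ShortComplex.mk (F.map (I.ι.f 0)) (F.map (I.cocomplex.d 0 1))
          (I.map_ι_f_zero_comp_map_d F))
      refine (ShortComplex.exact_and_mono_f_iff_of_iso ?_).2 (h.2 ⟨KernelFork.mapIsLimit _ I.isLimitKernelFork F⟩)
      have hι := CochainComplex.fromSingle₀Equiv_symm_apply_f_zero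
        (C := (F.mapHomologicalComplex _).obj I.cocomplex) (X := F.obj Y)
        (F.map (I.ι.f 0)) (I.map_ι_f_zero_comp_map_d F)
      exact ShortComplex.isoMk (Iso.refl _) (Iso.refl _) (Iso.refl _)
        ((Category.id_comp _).trans (hι.symm.trans (Category.comp_id _).symm))
        ((Category.id_comp _).trans (Category.comp_id _).symm)
    | succ n =>
      rw [quasiIsoAt_iff_exactAt _ _ (CochainComplex.exactAt_succ_single_obj _ _)]
      exact hF n⟩

end CategoryTheory.InjectiveResolution

namespace CategoryTheory.Adjunction

open InjectiveResolution

variable {C D : Type*} [Category* C] [Category* D] [Abelian C]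

lemma exists_comp_d_eq_iff {G : D ⥤ C} {F : C ⥤ D} (adj : G ⊣ F) (X : D) (K : CochainComplex C ℕ) (i j : ℕ)
    (f : G.obj X ⟶ K.X j) :
    (∃ g : G.obj X ⟶ K.X i, g ≫ K.d i j = f) ↔
      ∃ g : X ⟶ F.obj (K.X i), g ≫ F.map (K.d i j) = adj.homEquiv _ _ f := by
  constructor
  · rintro ⟨g, rfl⟩
    exact ⟨adj.homEquiv _ _ g, (adj.homEquiv_naturality_right _ _).symm⟩
  · rintro ⟨g, hg⟩
    refine ⟨(adj.homEquiv _ _).symm g, ?_⟩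
    rw [← adj.homEquiv_naturality_right_symm, hg, Equiv.symm_apply_apply]

variable [Abelian D] {G : D ⥤ C} {F : C ⥤ D} [G.Additive] [F.Additive]

/-- An additive adjunction identifies cocycles of `Hom(G X, K)` and `Hom(X, F K)`. -/
noncomputable def homCocyclesEquiv (adj : G ⊣ F) (X : D) (K : CochainComplex C ℕ) (n : ℕ) :
    homCocycles (G.obj X) K n ≃+ homCocycles X ((F.mapHomologicalComplex _).obj K) n where
  toFun f := ⟨adj.homAddEquiv _ _ f.1, by
    have hf : f.1 ≫ K.d n (n + 1) = 0 := f.2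
    change adj.homEquiv _ _ f.1 ≫ F.map (K.d n (n + 1)) = 0
    rw [← adj.homEquiv_naturality_right, hf, adj.homAddEquiv_zero]⟩
  invFun f := ⟨(adj.homAddEquiv _ _).symm f.1, by
    obtain ⟨f, hf⟩ := f
    change X ⟶ F.obj (K.X n) at f
    change f ≫ F.map (K.d n (n + 1)) = 0 at hf
    change (adj.homEquiv _ _).symm f ≫ K.d n (n + 1) = 0
    rw [← adj.homEquiv_naturality_right_symm, hf]
    exact (adj.homAddEquiv _ _).symm.map_zero⟩
  left_inv f := Subtype.ext ((adj.homAddEquiv _ _).left_inv f.1)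
  right_inv f := Subtype.ext ((adj.homAddEquiv _ _).right_inv f.1)
  map_add' f g := Subtype.ext ((adj.homAddEquiv _ _).map_add f.1 g.1)

variable [HasExt C]

/-- If the right adjoint `F` maps an injective resolution `I` of `Y` to an injective resolution
of `F.obj Y`, then `Ext (G.obj X) Y n` and `Ext X (F.obj Y) n` are isomorphic. -/
lemma nonempty_ext_addEquiv [HasExt D] (adj : G ⊣ F) {Y : C} (I : InjectiveResolution Y)
    (J : InjectiveResolution (F.obj Y))
    (hJ : J.cocomplex = (F.mapHomologicalComplex _).obj I.cocomplex) (X : D) (n : ℕ) :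
    Nonempty (Abelian.Ext (G.obj X) Y n ≃+ Abelian.Ext X (F.obj Y) n) := by
  cases n with
  | zero => exact ⟨Abelian.Ext.addEquiv₀.trans ((adj.homAddEquiv X Y).trans Abelian.Ext.addEquiv₀.symm)⟩
  | succ n =>
    obtain ⟨K, _, ι, _⟩ := J
    dsimp at hJ
    subst hJ
    set J : InjectiveResolution (F.obj Y) := { cocomplex := _, ι := ι }
    let φ := I.extMkHom (G.obj X) (n + 1)
    let ψ := (J.extMkHom X (n + 1)).comp
      (adj.homCocyclesEquiv X I.cocomplex (n + 1)).toAddMonoidHom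
    have hψ : Function.Surjective ψ :=
      (J.extMkHom_surjective X (n + 1)).comp (adj.homCocyclesEquiv X I.cocomplex (n + 1)).surjective
    have hker : φ.ker = ψ.ker := by
      ext f
      rw [I.mem_ker_extMkHom_iff, adj.exists_comp_d_eq_iff]
      exact (J.mem_ker_extMkHom_iff X n (adj.homCocyclesEquiv X I.cocomplex (n + 1) f)).symm
    exact ⟨(QuotientAddGroup.quotientKerEquivOfSurjective φ
      (I.extMkHom_surjective _ _)).symm.trans
      ((QuotientAddGroup.quotientAddEquivOfEq hker).trans
        (QuotientAddGroup.quotientKerEquivOfSurjective ψ hψ))⟩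

/-- If `Ext (G.obj P) Y (n + 1)` vanishes for all projective objects `P`, then the right adjoint `F`
maps injective resolutions of `Y` to complexes which are exact in degree `n + 1`. -/
lemma exactAt_of_subsingleton_ext [EnoughProjectives D] (adj : G ⊣ F) {Y : C}
    (I : InjectiveResolution Y) (n : ℕ)
    (h : ∀ (P : D) [Projective P], Subsingleton (Abelian.Ext (G.obj P) Y (n + 1))) :
    ((F.mapHomologicalComplex _).obj I.cocomplex).ExactAt (n + 1) := by
  rw [HomologicalComplex.exactAt_iff' _ n (n + 1) (n + 2) (by simp) (by simp),
    ShortComplex.exact_iff_exact_up_to_refinements]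
  intro A x hx
  let f : homCocycles (Projective.over A) ((F.mapHomologicalComplex _).obj I.cocomplex) (n + 1) :=
    ⟨Projective.π A ≫ x, by
      exact (Category.assoc _ _ _).trans ((congrArg _ hx).trans comp_zero)⟩
  obtain ⟨f', hf'⟩ := (adj.homCocyclesEquiv _ I.cocomplex (n + 1)).surjective f
  have := h (Projective.over A)
  obtain ⟨g, hg⟩ := (adj.exists_comp_d_eq_iff _ _ _ _ _).1
    ((I.mem_ker_extMkHom_iff _ n f').1 (Subsingleton.elim _ _))
  exact ⟨Projective.over A, Projective.π A, inferInstance, g,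
    (hg.trans (congrArg Subtype.val hf')).symm⟩

end CategoryTheory.Adjunction

theorem acyclic_iff_ext_iso
    {R S : Type u} [Ring R] [Ring S]
    (hR : IsGorensteinRing R) (hS : IsGorensteinRing S)
    (L : ModuleCat.{u} Rᵐᵒᵖ ⥤ ModuleCat.{u} Sᵐᵒᵖ)
    (G : ModuleCat.{u} Sᵐᵒᵖ ⥤ ModuleCat.{u} Rᵐᵒᵖ)
    (R' : ModuleCat.{u} Rᵐᵒᵖ ⥤ ModuleCat.{u} Sᵐᵒᵖ)
    [L.Additive] [G.Additive] [R'.Additive]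
    (adj₁ : L ⊣ G) (adj₂ : G ⊣ R')
    [G.Full] [G.Faithful]
    [PreservesFiniteLimits L] [PreservesFiniteColimits L]
    (m : ModuleCat.{u} Rᵐᵒᵖ) :
    (∀ j : ℕ, 0 < j → IsZero ((R'.rightDerived j).obj m)) ↔
      (∀ (n : ModuleCat.{u} Sᵐᵒᵖ) (j : ℕ),
        Nonempty (Ext (G.obj n) m j ≃+ Ext n (R'.obj m) j)) := by
  have := adj₂.rightAdjoint_preservesLimits
  have := adj₁.rightAdjoint_preservesLimits
  let I := InjectiveResolution.of m
  have hI (j : ℕ) : IsZero ((R'.rightDerived j).obj m) ↔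
      ((R'.mapHomologicalComplex _).obj I.cocomplex).ExactAt j := by
    rw [HomologicalComplex.exactAt_iff_isZero_homology]
    exact (I.isoRightDerivedObj R' j).isZero_iff
  constructor
  · intro h n j
    exact adj₂.nonempty_ext_addEquiv I
      (I.mapOfExactAt R' (fun X _ ↦ Injective.injective_of_adjoint adj₂ X)
        fun k ↦ (hI _).1 (h _ k.succ_pos)) rfl n j
  · rintro h (_ | j) hj
    · exact absurd hj (lt_irrefl 0)
    · refine (hI _).2 (adj₂.exactAt_of_subsingleton_ext I j fun P _ ↦ ?_)
      obtain ⟨e⟩ := h P (j + 1)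
      have := HasProjectiveDimensionLT.subsingleton P 1 (j + 1) (by lia) (R'.obj m)
      exact e.toEquiv.subsingleton
end

section
/- Let A be a subring of a ring B such that B is free as a left A-module and A is a direct summand of B as a right A-module (the inclusion A → B splits A-linearly on the right). If the injective dimension of B as a right B-module is at most d, then the injective dimension of A as a right A-module is at most d. -/
/-!
Statement 10: Let A be a subring of B (via an injective ring homomorphism ι : A →+* B) such
that B is free as a left A-module and A is a direct summand of B as a right A-module (the
inclusion splits via a right A-linear map σ : B → A).  If the injective dimension of B as a
right B-module is at most d, then the injective dimension of A as a right A-module is at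
most d.  Right A-modules are formalized as objects of `ModuleCat Aᵐᵒᵖ` and injective
dimension ≤ d is expressed by the vanishing of Ext^i(N, −) for i > d.  The left (resp.
right) A-module structure on B is given as data, compatible with ι.
-/

open CategoryTheory CategoryTheory.Abelian CategoryTheory.Limits MulOpposite

universe u

/-- The right ideal of `B` generated by a right ideal `I` of `A`, when `B` is free as a left
`A`-module: it consists of the elements all of whose coordinates lie in `I`. -/
def coordIdeal {A B Λ : Type*} [Ring A] [Ring B] (ι : A →+* B) [Module A B]
    (hleft : ∀ (a : A) (b : B), a • b = ι a * b) (e : Module.Basis Λ A B) (I : Ideal Aᵐᵒᵖ) :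
    Ideal Bᵐᵒᵖ where
  carrier := {x | ∀ l, op (e.repr x.unop l) ∈ I}
  add_mem' hx hy l := by simpa using I.add_mem (hx l) (hy l)
  zero_mem' l := by simp
  smul_mem' b x hx l := by
    have h : x.unop * b.unop =
        (e.repr x.unop).sum fun m a => a • (e m * b.unop) := by
      conv_lhs => rw [← e.linearCombination_repr x.unop, Finsupp.linearCombination_apply]
      rw [Finsupp.sum, Finset.sum_mul]
      simp only [Finsupp.sum, hleft, mul_assoc]
    have h' : op (e.repr (b • x).unop l) = ∑ m ∈ (e.repr x.unop).support,
        op (e.repr (e m * b.unop) l) * op (e.repr x.unop m) := by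
      rw [smul_eq_mul, unop_mul, h, Finsupp.sum, map_sum, Finsupp.finsetSum_apply]
      simp
    rw [h']
    exact I.sum_mem fun m _ => I.mul_mem_left _ (hx m)

section Coordinates

variable {A B Λ : Type*} [Ring A] [Ring B] {ι : A →+* B} [Module A B]
  {hleft : ∀ (a : A) (b : B), a • b = ι a * b} {e : Module.Basis Λ A B} {I : Ideal Aᵐᵒᵖ}

lemma op_mul_mem_coordIdeal (a : I) (y : B) :
    op (ι a.1.unop * y) ∈ coordIdeal ι hleft e I := fun l => by
  rw [unop_op, ← hleft, map_smul, Finsupp.smul_apply, smul_eq_mul, op_mul, op_unop]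
  exact I.mul_mem_left _ a.2

/-- The coordinates of an element of `coordIdeal`, as elements of the original ideal. -/
noncomputable def coordIdealRepr (x : coordIdeal ι hleft e I) : Λ →₀ I :=
  Finsupp.onFinset (e.repr x.1.unop).support (fun l => ⟨op (e.repr x.1.unop l), x.2 l⟩)
    fun l hl => by
      rw [Finsupp.mem_support_iff]
      rintro h
      exact hl (Subtype.ext (congrArg op h))

lemma coe_coordIdealRepr_apply (x : coordIdeal ι hleft e I) (l : Λ) :
    (coordIdealRepr x l : Aᵐᵒᵖ) = op (e.repr x.1.unop l) := rfl

lemma coordIdealRepr_add (x y : coordIdeal ι hleft e I) :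
    coordIdealRepr (x + y) = coordIdealRepr x + coordIdealRepr y := by
  ext l
  simp [coe_coordIdealRepr_apply]

lemma coordIdealRepr_op_mul (a : I) (y : B) :
    coordIdealRepr (⟨_, op_mul_mem_coordIdeal a y⟩ : coordIdeal ι hleft e I) =
      (e.repr y).mapRange (fun c => op c • a) (by simp) := by
  ext l
  simp [coe_coordIdealRepr_apply, ← hleft]

lemma coordIdeal_eq_sum (x : coordIdeal ι hleft e I) :
    x = (coordIdealRepr x).sum fun l a => ⟨op (ι a.1.unop * e l), op_mul_mem_coordIdeal a _⟩ := by
  have hs : (coordIdealRepr x).support = (e.repr x.1.unop).support := by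
    ext l
    simp [Subtype.ext_iff, coe_coordIdealRepr_apply]
  apply Subtype.ext
  apply unop_injective
  conv_lhs => rw [← e.linearCombination_repr x.1.unop, Finsupp.linearCombination_apply]
  simp [Finsupp.sum, hs, coe_coordIdealRepr_apply, hleft]

variable {Q : Type*} [AddCommGroup Q] [Module Aᵐᵒᵖ Q] [Module Bᵐᵒᵖ Q]

variable (hleft e) in
/-- The additive extension to `coordIdeal` of a linear map defined on an ideal of `A`. -/
noncomputable def coordIdealAddHom (f : I →ₗ[Aᵐᵒᵖ] Q) : coordIdeal ι hleft e I →+ Q :=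
  AddMonoidHom.mk' (fun x => (coordIdealRepr x).sum fun l a => op (e l) • f a) fun x y => by
    rw [coordIdealRepr_add, Finsupp.sum_add_index'] <;> simp

lemma coordIdealAddHom_op_mul (hQ : ∀ (a : A) (q : Q), op a • q = op (ι a) • q)
    (f : I →ₗ[Aᵐᵒᵖ] Q) (a : I) (y : B) :
    coordIdealAddHom hleft e f ⟨_, op_mul_mem_coordIdeal a y⟩ = op y • f a := by
  rw [coordIdealAddHom, AddMonoidHom.mk'_apply, coordIdealRepr_op_mul,
    Finsupp.sum_mapRange_index (by simp)]
  conv_rhs => rw [← e.linearCombination_repr y, Finsupp.linearCombination_apply]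
  simp [Finsupp.sum, Finset.sum_smul, hleft, hQ, mul_smul]

variable (hleft e) in
/-- The `B`-linear extension to `coordIdeal` of a linear map defined on an ideal of `A`. -/
noncomputable def coordIdealLift (hQ : ∀ (a : A) (q : Q), op a • q = op (ι a) • q)
    (f : I →ₗ[Aᵐᵒᵖ] Q) : coordIdeal ι hleft e I →ₗ[Bᵐᵒᵖ] Q where
  __ := coordIdealAddHom hleft e f
  map_smul' b x := by
    have h : ∀ l (a : I), b • (⟨op (ι a.1.unop * e l), op_mul_mem_coordIdeal a _⟩ :
        coordIdeal ι hleft e I) =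
          ⟨op (ι a.1.unop * (e l * b.unop)), op_mul_mem_coordIdeal a _⟩ := fun l a =>
      Subtype.ext (unop_injective (by simp [mul_assoc]))
    change coordIdealAddHom hleft e f (b • x) = b • coordIdealAddHom hleft e f x
    rw [coordIdeal_eq_sum x]
    simp only [Finsupp.sum, Finset.smul_sum, map_sum, h, coordIdealAddHom_op_mul hQ]
    simp [mul_smul]

/-- Restriction of scalars along `ι : A →+* B` preserves injective right modules when `B` is free
as a left `A`-module. -/
theorem baer_of_baer_of_basis (hleft : ∀ (a : A) (b : B), a • b = ι a * b)
    (e : Module.Basis Λ A B) (hQ : ∀ (a : A) (q : Q), op a • q = op (ι a) • q)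
    (h : Module.Baer Bᵐᵒᵖ Q) : Module.Baer Aᵐᵒᵖ Q := by
  intro I f
  obtain ⟨g, hg⟩ := h _ (coordIdealLift hleft e hQ f)
  refine ⟨LinearMap.toSpanSingleton Aᵐᵒᵖ Q (g 1), fun x hx => ?_⟩
  have h1 := hg _ (op_mul_mem_coordIdeal ⟨x, hx⟩ 1)
  have h2 : coordIdealLift hleft e hQ f ⟨_, op_mul_mem_coordIdeal ⟨x, hx⟩ 1⟩ =
      op (1 : B) • f ⟨x, hx⟩ := coordIdealAddHom_op_mul hQ f ⟨x, hx⟩ 1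
  rw [h2, op_one, one_smul, mul_one] at h1
  rw [← h1, LinearMap.toSpanSingleton_apply, show x • g 1 = op (ι x.unop) • g 1 from hQ _ _,
    ← map_smul, smul_eq_mul, mul_one]

end Coordinates

lemma hasInjectiveDimensionLE_restrictScalars {R S : Type u} [Ring R] [Ring S] (φ : R →+* S)
    [(ModuleCat.restrictScalars.{u} φ).PreservesInjectiveObjects] (n : ℕ) (M : ModuleCat.{u} S)
    [HasInjectiveDimensionLE M n] :
    HasInjectiveDimensionLE ((ModuleCat.restrictScalars φ).obj M) n := by
  induction n generalizing M with
  | zero =>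
    have hM : HasInjectiveDimensionLE M 0 := ‹_›
    simp only [HasInjectiveDimensionLE, zero_add, ← injective_iff_hasInjectiveDimensionLT_one]
      at hM ⊢
    exact (ModuleCat.restrictScalars φ).injective_obj M
  | succ n ih =>
    obtain ⟨J, hJ, f, hf⟩ := (inferInstance : EnoughInjectives (ModuleCat.{u} S)).1 M
    let T := ShortComplex.mk f (cokernel.π f) (cokernel.condition f)
    have hT : T.ShortExact := { exact := ShortComplex.exact_cokernel f }
    have hT' : (T.map (ModuleCat.restrictScalars φ)).ShortExact :=
      { exact := by
          have hE := hT.exact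
          rw [ShortComplex.ShortExact.moduleCat_exact_iff_function_exact] at hE ⊢
          exact hE
        mono_f := (ModuleCat.restrictScalars φ).map_mono T.f
        epi_g := (ModuleCat.restrictScalars φ).map_epi T.g }
    have := (hT.hasInjectiveDimensionLT_X₃_iff n hJ).mpr ‹_›
    exact (hT'.hasInjectiveDimensionLT_X₃_iff n
      ((ModuleCat.restrictScalars φ).injective_obj J)).mp (ih T.X₃)

lemma hasInjectiveDimensionLE_of_semilinear_retract {R S : Type u} [Ring R] [Ring S] (φ : R →+* S)
    [(ModuleCat.restrictScalars.{u} φ).PreservesInjectiveObjects] (n : ℕ) (M : ModuleCat.{u} S)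
    [HasInjectiveDimensionLE M n] {P : Type u} [AddCommGroup P] [Module R P]
    (i : P →ₛₗ[φ] M) (r : M →+ P) (hr : ∀ (a : R) (m : M), r (φ a • m) = a • r m)
    (hri : ∀ p, r (i p) = p) :
    HasInjectiveDimensionLE (ModuleCat.of R P) n := by
  have := hasInjectiveDimensionLE_restrictScalars φ n M
  let X := (ModuleCat.restrictScalars φ).obj M
  let pr : X →ₗ[R] P :=
    { toFun := r
      map_add' := map_add r
      map_smul' := hr }
  have h : Retract (ModuleCat.of R P) X :=
    { i := ModuleCat.semilinearMapAddEquiv φ (ModuleCat.of R P) M i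
      r := ModuleCat.ofHom (X := X) pr
      retract := ModuleCat.hom_ext (LinearMap.ext hri) }
  exact h.hasInjectiveDimensionLT (n + 1)

theorem injDim_le_of_subring_free_summand
    {A B : Type u} [Ring A] [Ring B] (ι : A →+* B) (hι : Function.Injective ι)
    [Module A B] (hleft : ∀ (a : A) (b : B), a • b = ι a * b)
    [Module Aᵐᵒᵖ B] (hright : ∀ (a : A) (b : B), op a • b = b * ι a)
    (hfree : Module.Free A B)
    (σ : B →ₗ[Aᵐᵒᵖ] A) (hσ : ∀ a : A, σ (ι a) = a)
    (d : ℕ)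
    (hB : ∀ (N : ModuleCat.{u} Bᵐᵒᵖ) (i : ℕ), d < i →
      Subsingleton (Ext N (ModuleCat.of Bᵐᵒᵖ B) i)) :
    ∀ (N : ModuleCat.{u} Aᵐᵒᵖ) (i : ℕ), d < i →
      Subsingleton (Ext N (ModuleCat.of Aᵐᵒᵖ A) i) := by
  have : HasInjectiveDimensionLE (ModuleCat.of Bᵐᵒᵖ B) d :=
    (hasInjectiveDimensionLT_iff _ _).mpr fun i hi N x => (hB N i hi).elim _ _
  have : (ModuleCat.restrictScalars.{u} ι.op).PreservesInjectiveObjects := ⟨fun {X} hX => by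
    rw [← Module.injective_iff_injective_object] at hX ⊢
    have hQ : ∀ (a : A) (q : (ModuleCat.restrictScalars ι.op).obj X),
        op a • q = op (ι a) • q := fun _ _ => rfl
    exact (baer_of_baer_of_basis hleft (Module.Free.chooseBasis A B) hQ
      (Module.Baer.of_injective hX)).injective⟩
  have := hasInjectiveDimensionLE_of_semilinear_retract ι.op d (ModuleCat.of Bᵐᵒᵖ B)
    { toFun := ι
      map_add' := map_add ι
      map_smul' := fun a x => map_mul ι x a.unop } σ.toAddMonoidHom
    (fun a (x : B) => by
      change σ (x * ι a.unop) = a • σ x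
      rw [← hright, op_unop, map_smul]) hσ
  intro N i hi
  exact HasInjectiveDimensionLT.subsingleton _ (d + 1) i hi N
end

section
/- Let S be a Gorenstein ring and let M be a Gorenstein injective right S-module. Then M is injective if and only if for every right ideal J of S, every S-module homomorphism S/J → M factors through an injective S-module. -/
/-!
Statement 12: Let S be a Gorenstein ring and M a Gorenstein injective right S-module.  Then
M is injective iff for every right ideal J of S, every S-module homomorphism S/J → M factors
through an injective S-module.  Right S-modules are formalized as objects of
`ModuleCat Sᵐᵒᵖ`; right ideals of S are submodules of S as a right S-module; Gorenstein
injectivity is expressed by the vanishing of Ext^i(E, −) for i ≥ 1 against all modules E of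
finite injective dimension.
-/

open CategoryTheory CategoryTheory.Abelian CategoryTheory.Limits

universe u

open DirectSum in
/-- Over a Noetherian ring, Baer's criterion is stable under direct sums. -/
theorem Module.Baer.directSum {A : Type*} [Ring A] [IsNoetherianRing A] {ι : Type*}
    (E : ι → Type*) [∀ i, AddCommGroup (E i)] [∀ i, Module A (E i)]
    (hE : ∀ i, Module.Baer A (E i)) : Module.Baer A (⨁ i, E i) := by
  classical
  intro I g
  choose g' hg' using fun i => hE i I (DirectSum.component A ι E i ∘ₗ g)
  obtain ⟨s, hs⟩ := IsNoetherian.noetherian (⊤ : Submodule A I)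
  let T : Finset ι := s.biUnion fun x => DFinsupp.support (g x)
  have hT : ∀ (x : I) (i : ι), i ∉ T → g x i = 0 := by
    intro x i hi
    have hle : Submodule.span A (s : Set I) ≤
        LinearMap.ker (DirectSum.component A ι E i ∘ₗ g) := by
      refine Submodule.span_le.2 fun y hy => ?_
      by_contra hne
      exact hi (Finset.mem_biUnion.2 ⟨y, hy, DFinsupp.mem_support_iff.2 hne⟩)
    exact hle (hs ▸ Submodule.mem_top)
  refine ⟨∑ i ∈ T, DirectSum.lof A ι E i ∘ₗ g' i, fun x hx => ?_⟩
  refine DFinsupp.ext fun i => ?_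
  change DirectSum.component A ι E i _ = _
  simp only [LinearMap.sum_apply, LinearMap.comp_apply, map_sum, DirectSum.component.of]
  by_cases hi : i ∈ T
  · rw [Finset.sum_eq_single i (fun j _ hj => by simp [hj]) (fun h => absurd hi h)]
    rw [dif_pos rfl]
    exact hg' i x hx
  · rw [hT _ i hi]
    refine Finset.sum_eq_zero fun j hj => dif_neg ?_
    rintro rfl
    exact hi hj

/-- The kernel of a map `p` out of a Baer module satisfies Baer's criterion as soon as every map
from a cyclic module to the target of `p` lifts along `p`. -/
theorem Module.Baer.ker {A : Type*} [Ring A] {P M : Type*} [AddCommGroup P] [AddCommGroup M]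
    [Module A P] [Module A M] (hP : Module.Baer A P) (p : P →ₗ[A] M)
    (hp : ∀ q : A →ₗ[A] M, ∃ g : A →ₗ[A] P, p ∘ₗ g = q ∧ LinearMap.ker q ≤ LinearMap.ker g) :
    Module.Baer A (LinearMap.ker p) := by
  intro I φ
  obtain ⟨ψ, hψ⟩ := hP I ((LinearMap.ker p).subtype ∘ₗ φ)
  obtain ⟨g, hg, hker⟩ := hp (p ∘ₗ ψ)
  refine ⟨(ψ - g).codRestrict (LinearMap.ker p) fun a => ?_, fun x hx => Subtype.ext ?_⟩
  · simpa [sub_eq_zero] using (LinearMap.congr_fun hg a).symm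
  · have hgx : g x = 0 := hker (by simp [hψ x hx])
    simp [hgx, hψ x hx]

/-- Over a Noetherian ring, a module `M` is injective if every map from a cyclic module to `M`
factors through an injective module. -/
theorem Module.Injective.of_cyclic_maps_factor {A : Type u} [Ring A] [IsNoetherianRing A]
    {M : Type u} [AddCommGroup M] [Module A M]
    (hM : ∀ q : A →ₗ[A] M, ∃ (E : ModuleCat.{u} A) (_ : Module.Injective A E)
      (g : A →ₗ[A] E) (h : E →ₗ[A] M), h ∘ₗ g = q ∧ LinearMap.ker q ≤ LinearMap.ker g) :
    Module.Injective A M := by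
  classical
  choose E hE g h hgh hker using hM
  let p := DirectSum.toModule A (A →ₗ[A] M) M h
  have hP := Module.Baer.directSum (A := A) (fun q => E q) fun q => Module.Baer.of_injective (hE q)
  have hp : ∀ q : A →ₗ[A] M, ∃ g : A →ₗ[A] (DirectSum (A →ₗ[A] M) fun q => E q),
      p ∘ₗ g = q ∧ LinearMap.ker q ≤ LinearMap.ker g := by
    refine fun q => ⟨DirectSum.lof A _ (fun q => E q) q ∘ₗ g q, ?_, fun x hx => ?_⟩
    · rw [← LinearMap.comp_assoc]
      convert hgh q
      ext x
      simp [p]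
    · simp [LinearMap.mem_ker.1 (hker q hx)]
  have hsurj : Function.Surjective p := by
    intro m
    obtain ⟨g, hg, -⟩ := hp (LinearMap.toSpanSingleton A M m)
    exact ⟨g 1, by simpa using LinearMap.congr_fun hg 1⟩
  obtain ⟨r, hr⟩ := (hP.ker p hp).extension_property (LinearMap.ker p).subtype
    (Submodule.injective_subtype _) LinearMap.id
  -- `id - r` kills `ker p`, hence induces a section of `p`.
  let d : (DirectSum (A →ₗ[A] M) fun q => E q) →ₗ[A] _ :=
    LinearMap.id - (LinearMap.ker p).subtype ∘ₗ r
  have hd : LinearMap.ker p ≤ LinearMap.ker d := fun x hx => by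
    have := LinearMap.congr_fun hr ⟨x, hx⟩
    simp only [LinearMap.comp_apply, Submodule.subtype_apply, LinearMap.id_apply] at this
    simp [d, this]
  let t : M →ₗ[A] _ := (LinearMap.ker p).liftQ d hd ∘ₗ (p.quotKerEquivOfSurjective hsurj).symm
  have ht : ∀ m, p (t m) = m := fun m => by
    obtain ⟨x, rfl⟩ := hsurj m
    have hx : (p.quotKerEquivOfSurjective hsurj).symm (p x) = Submodule.Quotient.mk x := by
      rw [LinearEquiv.symm_apply_eq]; rfl
    have hrx : p (r x) = 0 := (r x).2
    simp [t, hx, d, hrx]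
  refine Module.Baer.injective fun I φ => ?_
  obtain ⟨φ', hφ'⟩ := hP I (t ∘ₗ φ)
  exact ⟨p ∘ₗ φ', fun x hx => by simp [hφ' x hx, ht]⟩

theorem gorensteinInjective_injective_iff_cyclic_maps_factor
    {S : Type u} [Ring S] (hS : IsGorensteinRing S)
    (M : ModuleCat.{u} Sᵐᵒᵖ) (hM : IsGorensteinInjective Sᵐᵒᵖ M) :
    Injective M ↔
      ∀ (J : Submodule Sᵐᵒᵖ S) (f : ModuleCat.of Sᵐᵒᵖ (S ⧸ J) ⟶ M),
        ∃ (E : ModuleCat.{u} Sᵐᵒᵖ) (_ : Injective E)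
          (g : ModuleCat.of Sᵐᵒᵖ (S ⧸ J) ⟶ E) (h : E ⟶ M), f = g ≫ h := by
  refine ⟨fun hI _ f => ⟨M, hI, f, 𝟙 M, (Category.comp_id f).symm⟩, fun hf => ?_⟩
  have : IsNoetherianRing Sᵐᵒᵖ := hS.2.1
  let e : Sᵐᵒᵖ ≃ₗ[Sᵐᵒᵖ] S :=
    { MulOpposite.opAddEquiv.symm with map_smul' := fun _ _ => rfl }
  suffices Module.Injective Sᵐᵒᵖ M from Module.injective_object_of_injective_module Sᵐᵒᵖ M
  refine Module.Injective.of_cyclic_maps_factor fun q => ?_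
  let q' : S →ₗ[Sᵐᵒᵖ] M := q ∘ₗ e.symm.toLinearMap
  obtain ⟨E, hE, g, h, hgh⟩ := hf (LinearMap.ker q')
    (ModuleCat.ofHom ((LinearMap.ker q').liftQ q' le_rfl))
  refine ⟨E, Module.injective_module_of_injective_object Sᵐᵒᵖ E,
    g.hom ∘ₗ (LinearMap.ker q').mkQ ∘ₗ e.toLinearMap, h.hom, ?_, fun x hx => ?_⟩
  · ext
    have := ConcreteCategory.congr_hom hgh (Submodule.Quotient.mk (e 1))
    simpa [q'] using this.symm
  · have hx' : e x ∈ LinearMap.ker q' := by simpa [q'] using hx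
    have : (LinearMap.ker q').mkQ (e x) = 0 := (Submodule.Quotient.mk_eq_zero _).2 hx'
    simp only [LinearMap.mem_ker, LinearMap.comp_apply, LinearEquiv.coe_coe, this, map_zero]
end
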